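/- arXiv:2011.05535 — 3 statements merged into one kernel-verified Lean document; each statement's English description precedes it below -/
import Mathlib

section
/- Let E be a field of characteristic different from 2, let f ∈ E[X] be monic and square-free, and let g ∈ E[X] be coprime to f. Assume that every anisotropic regular quadratic form over E has dimension at most deg f. Then there exists a monic square-free polynomial g* ∈ E[X] such that deg g* < deg f, deg g* ≡ deg f − 1 (mod 2), and g·g* is congruent to the square of a polynomial modulo f. -/
open Polynomial

/-- Isotropy of the diagonal quadratic form `⟨a 0, …, a (n-1)⟩`. -/
def IsotropicDiag {R : Type*} [CommRing R] {n : ℕ} (a : Fin n → R) : Prop :=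
  ∃ x : Fin n → R, x ≠ 0 ∧ ∑ i, a i * x i ^ 2 = 0

/-- The value of the transfer form. -/
noncomputable def LL {E : Type*} [Field E] (f : E[X]) : E[X] →ₗ[E] E :=
  (Polynomial.lcoeff E (f.natDegree - 1)).comp (Polynomial.modByMonicHom f)

noncomputable def Qv {E : Type*} [Field E] (f g x : E[X]) : E := LL f (g * x ^ 2)

def UU {E : Type*} [Field E] (f g : E[X]) (c : E) : Prop :=
  ∃ x, IsCoprime f x ∧ Qv f g x = c

section
variable {E : Type*} [Field E]

lemma LL_apply (f a : E[X]) : LL f a = (a %ₘ f).coeff (f.natDegree - 1) := rfl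

lemma LL_congr {f : E[X]} (hf : f.Monic) {a b : E[X]} (h : f ∣ a - b) : LL f a = LL f b := by
  rw [LL_apply, LL_apply, modByMonic_eq_of_dvd_sub hf h]

lemma LL_dvd {f : E[X]} (hf : f.Monic) {a : E[X]} (h : f ∣ a) : LL f a = 0 := by
  rw [LL_congr hf (b := 0) (by simpa using h), map_zero]

lemma mul_mod {f1 f2 : E[X]} (h1 : f1.Monic) (h2 : f2.Monic) (a : E[X]) :
    (f2 * a) %ₘ (f1 * f2) = f2 * (a %ₘ f1) := by
  refine (div_modByMonic_unique (a /ₘ f1) _ (h1.mul h2) ⟨?_, ?_⟩).2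
  · conv_rhs => rw [← modByMonic_add_div a f1]
    ring
  · rw [mul_comm, degree_mul, degree_mul]
    have := degree_modByMonic_lt a h1
    have h20 : f2.degree ≠ ⊥ := by simpa using h2.ne_zero
    exact WithBot.add_lt_add_right h20 this

lemma LL_mul {f1 f2 : E[X]} (h1 : f1.Monic) (h2 : f2.Monic) (a : E[X]) :
    LL (f1 * f2) (f2 * a) = LL f1 a := by
  rw [LL_apply, LL_apply, mul_mod h1 h2]
  by_cases hd : f1.natDegree = 0
  · have : f1 = 1 := eq_one_of_monic_natDegree_zero h1 hd
    subst this; simp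
  · have hlt := natDegree_modByMonic_lt a h1 (by rintro rfl; simp at hd)
    have e : (f1 * f2).natDegree - 1 = f2.natDegree + (f1.natDegree - 1) := by
      rw [h1.natDegree_mul h2]; omega
    rw [e, coeff_mul_add_eq_of_natDegree_le le_rfl (by omega), h2.coeff_natDegree, one_mul]

lemma Qv_mul {f1 f2 : E[X]} (h1 : f1.Monic) (h2 : f2.Monic) (g a : E[X]) :
    Qv (f1 * f2) g (f2 * a) = Qv f1 (g * f2) a := by
  unfold Qv
  rw [← LL_mul h1 h2]; congr 1; ring

lemma UU_comb {f1 f2 g : E[X]} {c1 c2 : E} (h1 : f1.Monic) (h2 : f2.Monic) (hc : IsCoprime f1 f2)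
    (hU1 : UU f1 (g * f2) c1) (hU2 : UU f2 (g * f1) c2) : UU (f1 * f2) g (c1 + c2) := by
  obtain ⟨x1, hx1, rfl⟩ := hU1
  obtain ⟨x2, hx2, rfl⟩ := hU2
  refine ⟨f2 * x1 + f1 * x2, ?_, ?_⟩
  · refine IsCoprime.mul_left ?_ ?_
    · exact (IsCoprime.add_mul_left_right (hc.mul_right hx1) x2)
    · rw [add_comm]
      exact (IsCoprime.add_mul_left_right (hc.symm.mul_right hx2) x1)
  · rw [← Qv_mul h1 h2, ← Qv_mul h2 h1, mul_comm f2 f1]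
    unfold Qv
    rw [← map_add]
    apply LL_congr (h1.mul h2)
    exact ⟨2 * g * x1 * x2, by ring⟩

lemma UU_scale {f g : E[X]} {c t : E} (ht : t ≠ 0) (h : UU f g c) : UU f g (c * t ^ 2) := by
  obtain ⟨x, hx, rfl⟩ := h
  refine ⟨C t * x, ?_, ?_⟩
  · exact (isCoprime_mul_unit_left_right (isUnit_C.2 (isUnit_iff_ne_zero.2 ht)) _ _).2 hx
  · unfold Qv
    rw [show g * (C t * x) ^ 2 = (t ^ 2) • (g * x ^ 2) by
      rw [smul_eq_C_mul, C_pow]; ring, map_smul, smul_eq_mul, mul_comm]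

lemma diag (h2 : (2 : E) ≠ 0) {f g : E[X]} (hf : f.Monic) (hc : IsCoprime f g) :
    ∃ (e : Fin f.natDegree → E[X]) (w : Fin f.natDegree → E), (∀ i, w i ≠ 0) ∧
      (∀ x : Fin f.natDegree → E, Qv f g (∑ i, x i • e i) = ∑ i, w i * x i ^ 2) ∧
      (∀ x : Fin f.natDegree → E, f ∣ ∑ i, x i • e i → x = 0) := by
  classical
  set n := f.natDegree with hn
  let V := degreeLT E n
  let B : LinearMap.BilinForm E V := LinearMap.mk₂ E (fun x y => LL f (g * (x : E[X]) * y))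
    (by intro a b c; simp [mul_add, add_mul]) (by intro a b c; simp)
    (by intro a b c; simp [mul_add]) (by intro a b c; simp)
  have hB : ∀ x y, B x y = LL f (g * (x : E[X]) * y) := fun x y => rfl
  have : FiniteDimensional E V := (degreeLTEquiv E n).symm.finiteDimensional
  have hfr : Module.finrank E V = n := by
    rw [(degreeLTEquiv E n).finrank_eq]; simp
  have : Invertible (2 : E) := invertibleOfNonzero h2
  have hsymm : LinearMap.IsSymm B := ⟨by
    intro x y; simp only [hB, RingHom.id_apply]; congr 1; ring⟩
  have hmem : ∀ x : V, f ∣ (x : E[X]) → x = 0 := by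
    intro x hx
    have h := mem_degreeLT.1 x.2
    rw [hn, ← degree_eq_natDegree hf.ne_zero] at h
    exact Subtype.ext (eq_zero_of_dvd_of_degree_lt hx h)
  have hsep : ∀ x : V, (∀ y, B x y = 0) → x = 0 := by
    intro x hx
    by_contra hne
    have h1 : ∀ y : E[X], LL f (g * (x : E[X]) * y) = 0 := by
      intro y
      have hy : y %ₘ f ∈ degreeLT E n := by
        rw [mem_degreeLT, hn, ← degree_eq_natDegree hf.ne_zero]
        exact degree_modByMonic_lt y hf
      have := hx ⟨_, hy⟩
      rw [hB] at this
      rw [← this]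
      apply LL_congr hf
      refine ⟨g * x * (y /ₘ f), ?_⟩
      conv_lhs => enter [1]; rw [← modByMonic_add_div y f]
      ring
    set r := (g * (x : E[X])) %ₘ f with hr
    have hr0 : r ≠ 0 := by
      intro h0
      rw [hr, modByMonic_eq_zero_iff_dvd hf] at h0
      exact hne (hmem x (hc.dvd_of_dvd_mul_left h0))
    have hf1 : f ≠ 1 := by
      rintro rfl
      exact hne (hmem x (one_dvd _))
    have hlt : r.natDegree < n := natDegree_modByMonic_lt _ hf hf1
    obtain ⟨k, hk⟩ : ∃ k, f.natDegree - 1 = r.natDegree + k := ⟨n - 1 - r.natDegree, by omega⟩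
    have h3 := h1 (X ^ k)
    rw [LL_congr hf (b := r * X ^ k) ?_, LL_apply,
      (modByMonic_eq_self_iff hf).2 ?_] at h3
    · rw [hk, coeff_mul_X_pow] at h3
      exact hr0 (leadingCoeff_eq_zero.1 h3)
    · rw [degree_mul, degree_X_pow, degree_eq_natDegree hr0, degree_eq_natDegree hf.ne_zero]
      norm_cast; omega
    · rw [← sub_mul]
      apply Dvd.dvd.mul_right
      rw [hr]
      refine ⟨(g * (x : E[X])) /ₘ f, ?_⟩
      conv_lhs => enter [1]; rw [← modByMonic_add_div (g * (x : E[X])) f]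
      ring
  have hnd : B.Nondegenerate := ⟨hsep, by
    intro y hy
    apply hsep
    intro x
    rw [← hy x, hB, hB]; congr 1; ring⟩
  obtain ⟨v, hv⟩ := LinearMap.BilinForm.exists_orthogonal_basis hsymm
  have hv0 := LinearMap.BilinForm.iIsOrtho.not_isOrtho_basis_self_of_nondegenerate hv hnd
  let b := v.reindex (finCongr hfr)
  have hb : ∀ i j, i ≠ j → B (b i) (b j) = 0 := by
    intro i j hij
    simp only [b, Module.Basis.reindex_apply]
    exact hv (fun h => hij (by simpa using h))
  have key : ∀ x : Fin n → E, ((∑ i, x i • b i : V) : E[X]) = ∑ i, x i • (b i : E[X]) := by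
    intro x; simp
  refine ⟨fun i => (b i : E[X]), fun i => B (b i) (b i), ?_, ?_, ?_⟩
  · intro i
    simp only [b, Module.Basis.reindex_apply]
    exact hv0 _
  · intro x
    rw [← key, Qv, show ∀ z : E[X], g * z ^ 2 = g * z * z by intro z; ring, ← hB]
    simp only [map_sum, LinearMap.sum_apply, map_smul, LinearMap.smul_apply, smul_eq_mul]
    refine Finset.sum_congr rfl fun i _ => ?_
    rw [Finset.sum_eq_single i]
    · ring
    · intro j _ hj; simp [hb _ _ hj]
    · simp
  · intro x hx
    rw [← key] at hx
    have := hmem _ hx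
    have h := Fintype.linearIndependent_iff.1 b.linearIndependent x this
    exact funext h

lemma nz (h2 : (2 : E) ≠ 0) {p g : E[X]} (hp : p.Monic) (hirr : Irreducible p)
    (hc : IsCoprime p g) : ∃ c, c ≠ 0 ∧ UU p g c := by
  classical
  obtain ⟨e, w, hw, hq, hd⟩ := diag h2 hp hc
  let i : Fin p.natDegree := ⟨0, hirr.natDegree_pos⟩
  have h := hq (Pi.single i 1)
  refine ⟨w i, hw i, ∑ j, (Pi.single i (1 : E) : Fin p.natDegree → E) j • e j, ?_, ?_⟩
  · rw [hirr.coprime_iff_not_dvd]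
    intro hdv
    have := congrFun (hd _ hdv) i
    simp at this
  · rw [h, Finset.sum_eq_single i]
    · simp
    · intro j _ hj; simp [hj]
    · simp

lemma rep1 (h2 : (2 : E) ≠ 0) {f g : E[X]} (hf : f.Monic) (hc : IsCoprime f g)
    (hu : ∀ (n : ℕ) (a : Fin n → E), (∀ i, a i ≠ 0) → f.natDegree < n → IsotropicDiag a) :
    ∃ v, Qv f g v = 1 := by
  classical
  obtain ⟨e, w, hw, hq, hd⟩ := diag h2 hf hc
  suffices ∃ y : Fin f.natDegree → E, ∑ i, w i * y i ^ 2 = 1 by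
    obtain ⟨y, hy⟩ := this
    exact ⟨_, (hq y).trans hy⟩
  obtain ⟨x, hx0, hx⟩ := hu (f.natDegree + 1) (Fin.cons (-1) w) (by
    intro i; refine Fin.cases ?_ ?_ i <;> simp [hw]) (by omega)
  rw [Fin.sum_univ_succ] at hx
  simp only [Fin.cons_zero, Fin.cons_succ] at hx
  by_cases h0 : x 0 = 0
  · have : ∃ j : Fin f.natDegree, x j.succ ≠ 0 := by
      by_contra hcon
      push Not at hcon
      apply hx0
      funext i
      refine Fin.cases h0 hcon i
    obtain ⟨j, hj⟩ := this
    have hx' : ∑ i : Fin f.natDegree, w i * x i.succ ^ 2 = 0 := by simpa [h0] using hx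
    have hs : ∀ t : E, ∑ i : Fin f.natDegree, w i * (t * x i.succ + (if i = j then 1 else 0)) ^ 2
        = 2 * t * w j * x j.succ + w j := by
      intro t
      have : ∀ i : Fin f.natDegree, w i * (t * x i.succ + (if i = j then 1 else 0)) ^ 2
        = t ^ 2 * (w i * x i.succ ^ 2) + (if i = j then 2 * t * w i * x i.succ + w i else 0) := by
        intro i; split_ifs <;> ring
      simp_rw [this]
      rw [Finset.sum_add_distrib, ← Finset.mul_sum, hx']
      simp
    refine ⟨_, (hs ((1 - w j) / (2 * w j * x j.succ))).trans ?_⟩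
    have := hw j
    field_simp
    ring
  · refine ⟨fun i => x i.succ / x 0, ?_⟩
    simp_rw [div_pow, ← mul_div_assoc]
    rw [← Finset.sum_div, div_eq_one_iff_eq (pow_ne_zero 2 h0)]
    linear_combination hx

def Concl (f g : E[X]) : Prop := ∃ gs : E[X], gs.Monic ∧ Squarefree gs ∧
      gs.natDegree < f.natDegree ∧ gs.natDegree % 2 = (f.natDegree - 1) % 2 ∧
      ∃ s : E[X], f ∣ g * gs - s ^ 2

lemma sqf (n : ℕ) : ∀ h : E[X], h.natDegree = n → h.Monic →
    ∃ a r : E[X], a.Monic ∧ Squarefree a ∧ h = a * r ^ 2 := by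
  induction n using Nat.strong_induction_on with
  | _ n ih =>
  intro h hn hm
  by_cases hs : Squarefree h
  · exact ⟨h, 1, hm, hs, by simp⟩
  · have : ∃ d : E[X], d * d ∣ h ∧ ¬ IsUnit d := by
      simpa [Squarefree] using hs
    obtain ⟨d, hd, hu⟩ := this
    obtain ⟨p, hpm, hpi, hpd⟩ := exists_monic_irreducible_factor d hu
    obtain ⟨k, hk⟩ := (mul_dvd_mul hpd hpd).trans hd
    have hkm : k.Monic := (hpm.mul hpm).of_mul_monic_left (hk ▸ hm)
    have hdeg : h.natDegree = p.natDegree + p.natDegree + k.natDegree := by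
      rw [hk, (hpm.mul hpm).natDegree_mul hkm, hpm.natDegree_mul hpm]
    have := hpi.natDegree_pos
    obtain ⟨a, r, ha, has, har⟩ := ih k.natDegree (by omega) k rfl hkm
    exact ⟨a, p * r, ha, has, by rw [hk, har]; ring⟩

lemma h_of_Q {f g x : E[X]} (hf : f.Monic) (hd : 0 < f.natDegree) (hQ : Qv f g x = 1) :
    ∃ h : E[X], h.Monic ∧ h.natDegree = f.natDegree - 1 ∧ f ∣ g * x ^ 2 - h := by
  refine ⟨(g * x ^ 2) %ₘ f, ?_, ?_, ?_⟩
  rotate_left 2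
  · refine ⟨(g * x ^ 2) /ₘ f, ?_⟩
    conv_lhs => enter [1]; rw [← modByMonic_add_div (g * x ^ 2) f]
    ring
  all_goals
    have hlt := natDegree_modByMonic_lt (g * x ^ 2) hf (by rintro rfl; simp at hd)
    have hQ' : ((g * x ^ 2) %ₘ f).coeff (f.natDegree - 1) = 1 := hQ
  · exact monic_of_natDegree_le_of_coeff_eq_one _ (by omega) hQ'
  · exact natDegree_eq_of_le_of_coeff_ne_zero (by omega) (by rw [hQ']; exact one_ne_zero)

lemma finU {f g : E[X]} (hf : f.Monic) (hd : 0 < f.natDegree) (hc : IsCoprime f g)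
    (hU : UU f g 1) : Concl f g := by
  obtain ⟨x, hx, hQ⟩ := hU
  obtain ⟨h, hm, hdeg, hdvd⟩ := h_of_Q hf hd hQ
  obtain ⟨a, r, ha, has, har⟩ := sqf _ h rfl hm
  have hcop : IsCoprime f h := by
    obtain ⟨k, hk⟩ := hdvd
    have : h = g * x ^ 2 + f * (-k) := by linear_combination -hk
    rw [this]
    exact IsCoprime.add_mul_left_right (hc.mul_right (hx.pow_right)) _
  have hr : IsCoprime f r := by
    rw [har] at hcop
    exact (IsCoprime.pow_right_iff (by norm_num)).1 hcop.of_mul_right_right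
  have hr0 : r ≠ 0 := by rintro rfl; rw [har] at hm; simp at hm
  have hdd : h.natDegree = a.natDegree + 2 * r.natDegree := by
    rw [har, natDegree_mul ha.ne_zero (pow_ne_zero _ hr0), natDegree_pow]
  obtain ⟨u, v, huv⟩ := hr
  refine ⟨a, ha, has, by omega, by omega, g * x * v, ?_⟩
  obtain ⟨k, hk⟩ := hdvd
  rw [har] at hk
  refine ⟨-g * v ^ 2 * k + g * a * u * (1 + v * r), ?_⟩
  linear_combination (-g * v ^ 2) * hk - g * a * (1 + v * r) * huv

lemma finD2 {f g v : E[X]} (hf : f.Monic) (hd : f.natDegree = 2)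
    (hQ : Qv f g v = 1) : Concl f g := by
  obtain ⟨h, hm, hdeg, k, hk⟩ := h_of_Q hf (by omega) hQ
  refine ⟨h, hm, ?_, by omega, by omega, g * v, -g * k, by linear_combination (-g) * hk⟩
  exact (irreducible_of_degree_eq_one ((degree_eq_iff_natDegree_eq_of_pos Nat.one_pos).2
    (by omega))).squarefree

lemma finL {P l g : E[X]} (hP : P.Monic) (hl : l.Monic) (hd : l.natDegree = 1)
    (hs : Squarefree P) (hU : UU l (g * P) 1) : Concl (P * l) g := by
  obtain ⟨x, -, hQ⟩ := hU
  obtain ⟨h, hm, hdeg, k, hk⟩ := h_of_Q hl (by omega) hQ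
  have h1 : h = 1 := eq_one_of_monic_natDegree_zero hm (by omega)
  subst h1
  have e := hP.natDegree_mul hl
  refine ⟨P, hP, hs, by omega, by rw [e, hd]; simp, g * P * x, -g * k, ?_⟩
  linear_combination (-g * P) * hk

lemma finR {p q g v : E[X]} (hp : p.Monic) (hq : q.Monic) (hd : q.natDegree = 2)
    (hirr : Irreducible p) (hpd : 2 ≤ p.natDegree) (hQ : Qv q (g * p) v = 1) :
    Concl (p * q) g := by
  obtain ⟨h, hm, hdeg, k, hk⟩ := h_of_Q hq (by omega) hQ
  have e := hp.natDegree_mul hq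
  have e2 := hp.natDegree_mul hm
  have hhs : Irreducible h :=
    (irreducible_of_degree_eq_one ((degree_eq_iff_natDegree_eq_of_pos Nat.one_pos).2
    (by omega)))
  refine ⟨p * h, hp.mul hm, ?_, by omega, by omega, g * p * v, -g * k, ?_⟩
  · rw [squarefree_mul_iff]
    refine ⟨?_, hirr.squarefree, hhs.squarefree⟩
    refine IsCoprime.isRelPrime ?_
    rw [hirr.coprime_iff_not_dvd]
    intro hdv
    have := natDegree_le_of_dvd hdv hm.ne_zero
    omega
  · linear_combination (-g * p) * hk

lemma sq_cop {a b : E[X]} (h : Squarefree (a * b)) : IsCoprime a b ∧ Squarefree a ∧ Squarefree b := by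
  rw [squarefree_mul_iff] at h
  exact ⟨h.1.isCoprime, h.2⟩

lemma big (h2 : (2 : E) ≠ 0)
    (hbig : ∀ c : E, c ≠ 0 → ∃ a b : E, a ≠ 0 ∧ b ≠ 0 ∧ a ^ 2 + c * b ^ 2 = 1) (n : ℕ) :
    ∀ f1 f2 g : E[X], f2.natDegree = n → f1.Monic → f2.Monic → Squarefree (f1 * f2) →
      IsCoprime (f1 * f2) g → UU f1 (g * f2) 1 → UU (f1 * f2) g 1 := by
  induction n using Nat.strong_induction_on with
  | _ n ih =>
  intro f1 f2 g hn h1 hf2 hs hc hU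
  by_cases hd : f2.natDegree = 0
  · have := eq_one_of_monic_natDegree_zero hf2 hd
    subst this
    simpa using hU
  · obtain ⟨p, hpm, hpi, f3, rfl⟩ := exists_monic_irreducible_factor f2
      (fun h => hd (natDegree_eq_zero_of_isUnit h))
    have h3 : f3.Monic := hpm.of_mul_monic_left hf2
    have hdeg := hpm.natDegree_mul h3
    have := hpi.natDegree_pos
    rw [← mul_assoc] at hs hc ⊢
    obtain ⟨c1, s1, s3⟩ := sq_cop hs
    obtain ⟨c2, -, -⟩ := sq_cop s1
    refine ih f3.natDegree (by omega) (f1 * p) f3 g rfl (h1.mul hpm) h3 hs hc ?_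
    have hpg : IsCoprime p (g * f3 * f1) :=
      (hc.of_mul_left_left.of_mul_left_right.mul_right c1.of_mul_left_right).mul_right c2.symm
    obtain ⟨c, hc0, hUc⟩ := nz h2 hpm hpi hpg
    obtain ⟨a, b, ha, hb, hab⟩ := hbig c hc0
    rw [← hab]
    refine UU_comb h1 hpm c2 ?_ (UU_scale hb hUc)
    have := UU_scale ha hU
    rwa [one_mul, mul_comm p, ← mul_assoc] at this

lemma bigConcl (h2 : (2 : E) ≠ 0)
    (hbig : ∀ c : E, c ≠ 0 → ∃ a b : E, a ≠ 0 ∧ b ≠ 0 ∧ a ^ 2 + c * b ^ 2 = 1)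
    {f g v : E[X]} (hf : f.Monic) (hs : Squarefree f) (hc : IsCoprime f g) (hQ : Qv f g v = 1) :
    UU f g 1 := by
  classical
  have hg0 : EuclideanDomain.gcd f v ≠ 0 := by
    intro h
    exact hf.ne_zero (EuclideanDomain.gcd_eq_zero_iff.1 h).1
  set d := EuclideanDomain.gcd f v with hd
  obtain ⟨f2, hf2, hdf⟩ : ∃ f2 : E[X], f2.Monic ∧ Associated d f2 := by
    refine ⟨d * C d.leadingCoeff⁻¹, monic_mul_leadingCoeff_inv hg0, ?_⟩
    refine associated_mul_unit_right _ _ (isUnit_C.2 (isUnit_iff_ne_zero.2 ?_))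
    simpa using hg0
  obtain ⟨f1, rfl⟩ := hdf.dvd_iff_dvd_left.1 (EuclideanDomain.gcd_dvd_left f v)
  obtain ⟨y, rfl⟩ := hdf.dvd_iff_dvd_left.1 (EuclideanDomain.gcd_dvd_right _ v)
  have h1 : f1.Monic := hf2.of_mul_monic_left hf
  obtain ⟨c1, -, -⟩ := sq_cop hs
  rw [mul_comm f2 f1] at hs hc hQ ⊢
  refine big h2 hbig _ f1 f2 g rfl h1 hf2 hs hc ⟨y, ?_, ?_⟩
  · refine IsRelPrime.isCoprime fun z hz1 hz2 => ?_
    have : z ∣ f2 := hdf.dvd_iff_dvd_right.1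
      (EuclideanDomain.dvd_gcd (hz1.mul_left _) (hz2.mul_left _))
    exact c1.isUnit_of_dvd' this hz1
  · rw [← Qv_mul h1 hf2, hQ]

lemma anyU (h2 : (2 : E) ≠ 0) (n : ℕ) : ∀ f g : E[X], f.natDegree = n → f.Monic → Squarefree f →
    IsCoprime f g → ∃ c, UU f g c := by
  induction n using Nat.strong_induction_on with
  | _ n ih =>
  intro f g hn hf hs hc
  by_cases hd : f.natDegree = 0
  · have := eq_one_of_monic_natDegree_zero hf hd
    subst this
    exact ⟨_, 1, isCoprime_one_left, rfl⟩
  · obtain ⟨p, hpm, hpi, f3, rfl⟩ := exists_monic_irreducible_factor f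
      (fun h => hd (natDegree_eq_zero_of_isUnit h))
    have h3 : f3.Monic := hpm.of_mul_monic_left hf
    have hdeg := hpm.natDegree_mul h3
    have := hpi.natDegree_pos
    obtain ⟨c1, -, s3⟩ := sq_cop hs
    obtain ⟨c, -, hU1⟩ := nz h2 hpm hpi (hc.of_mul_left_left.mul_right c1)
    obtain ⟨c', hU2⟩ := ih f3.natDegree (by omega) f3 (g * p) rfl h3 s3
      (hc.of_mul_left_right.mul_right c1.symm)
    exact ⟨_, UU_comb hpm h3 c1 hU1 hU2⟩

def TT (f : E[X]) : Prop := ∀ g, IsCoprime f g → ∀ c, c ≠ 0 → UU f g c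

lemma T_irr (h2 : (2 : E) ≠ 0)
    (hE : ∀ w0 w1 c : E, w0 ≠ 0 → w1 ≠ 0 → c ≠ 0 → ∃ a b, w0 * a ^ 2 + w1 * b ^ 2 = c)
    {p : E[X]} (hp : p.Monic) (hirr : Irreducible p) (hd : 2 ≤ p.natDegree) : TT p := by
  classical
  intro g hc c hc0
  obtain ⟨e, w, hw, hq, -⟩ := diag h2 hp hc
  let i : Fin p.natDegree := ⟨0, by omega⟩
  let j : Fin p.natDegree := ⟨1, by omega⟩
  have hij : j ≠ i := by simp [i, j]
  obtain ⟨a, b, hab⟩ := hE (w i) (w j) c (hw i) (hw j) hc0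
  have h := hq (fun k => if k = i then a else if k = j then b else 0)
  have hval : ∑ k, w k * (if k = i then a else if k = j then b else 0) ^ 2 = c := by
    rw [← Finset.add_sum_erase _ _ (Finset.mem_univ i),
      ← Finset.add_sum_erase _ _ (Finset.mem_erase.2 ⟨hij, Finset.mem_univ j⟩),
      Finset.sum_eq_zero]
    · simp [hij, hab]
    · intro k hk
      simp only [Finset.mem_erase] at hk
      simp [hk.1, hk.2.1]
  rw [hval] at h
  refine ⟨_, ?_, h⟩
  rw [hirr.coprime_iff_not_dvd]
  intro hdv
  apply hc0
  rw [← h, Qv]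
  exact LL_dvd hp ((dvd_pow hdv two_ne_zero).mul_left _)

lemma deg_unit {f : E[X]} (hf : 0 < f.natDegree) : ¬ IsUnit f := fun h => by
  rw [natDegree_eq_zero_of_isUnit h] at hf; omega

lemma exfac {f : E[X]} (hm : f.Monic) (hf : 0 < f.natDegree) : ∃ p q : E[X], p.Monic ∧ q.Monic ∧
    Irreducible p ∧ f = p * q := by
  obtain ⟨p, hpm, hpi, q, rfl⟩ := exists_monic_irreducible_factor f (deg_unit hf)
  exact ⟨p, q, hpm, hpm.of_mul_monic_left hm, hpi, rfl⟩

lemma T_mul5 (h2 : (2 : E) ≠ 0) (e : ZMod 5 ≃+* E) {f1 f2 : E[X]} (h1 : f1.Monic) (hf2 : f2.Monic)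
    (hs : Squarefree (f1 * f2)) (hT : TT f1) : TT (f1 * f2) := by
  intro g hc c hc0
  obtain ⟨c1, -, s2⟩ := sq_cop hs
  obtain ⟨c2, hU2⟩ := anyU h2 _ f2 (g * f1) rfl hf2 s2 (hc.of_mul_left_right.mul_right c1.symm)
  have : ∃ t : E, t ≠ 0 ∧ c - c2 * t ^ 2 ≠ 0 := by
    obtain ⟨c, rfl⟩ := e.surjective c
    obtain ⟨c2, rfl⟩ := e.surjective c2
    have key : ∀ c c2 : ZMod 5, c ≠ 0 → ∃ t : ZMod 5, t ≠ 0 ∧ c - c2 * t ^ 2 ≠ 0 := by decide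
    obtain ⟨t, ht, h⟩ := key c c2 (by simpa using hc0)
    refine ⟨e t, by simpa using ht, ?_⟩
    rw [← map_pow, ← map_mul, ← map_sub]
    exact (map_ne_zero_iff e e.injective).2 h
  obtain ⟨t, ht, h⟩ := this
  have := UU_comb h1 hf2 c1 (hT (g * f2) (hc.of_mul_left_left.mul_right c1) _ h) (UU_scale ht hU2)
  simpa using this

lemma three5 (h2 : (2 : E) ≠ 0) (e : ZMod 5 ≃+* E) {p q r : E[X]} (hp : p.Monic) (hq : q.Monic)
    (hr : r.Monic) (ip : Irreducible p) (iq : Irreducible q) (ir : Irreducible r)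
    (hs : Squarefree (p * q * r)) : TT (p * q * r) := by
  intro g hc c hc0
  obtain ⟨c1, s1, -⟩ := sq_cop hs
  obtain ⟨c2, -, -⟩ := sq_cop s1
  have gp := hc.of_mul_left_left.of_mul_left_left
  have gq := hc.of_mul_left_left.of_mul_left_right
  have gr := hc.of_mul_left_right
  have pr := c1.of_mul_left_left
  have qr := c1.of_mul_left_right
  obtain ⟨a1, ha1, hU1⟩ := nz h2 hp ip ((gp.mul_right pr).mul_right c2)
  obtain ⟨a2, ha2, hU2⟩ := nz h2 hq iq ((gq.mul_right qr).mul_right c2.symm)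
  obtain ⟨a3, ha3, hU3⟩ := nz h2 hr ir (gr.mul_right c1.symm)
  have : ∃ t1 t2 t3 : E, t1 ≠ 0 ∧ t2 ≠ 0 ∧ t3 ≠ 0 ∧ a1 * t1 ^ 2 + a2 * t2 ^ 2 + a3 * t3 ^ 2 = c := by
    obtain ⟨c, rfl⟩ := e.surjective c
    obtain ⟨a1, rfl⟩ := e.surjective a1
    obtain ⟨a2, rfl⟩ := e.surjective a2
    obtain ⟨a3, rfl⟩ := e.surjective a3
    have key : ∀ a1 a2 a3 c : ZMod 5, a1 ≠ 0 → a2 ≠ 0 → a3 ≠ 0 → c ≠ 0 →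
      ∃ t1 ∈ ({1, 2} : Finset (ZMod 5)), ∃ t2 ∈ ({1, 2} : Finset (ZMod 5)),
      ∃ t3 ∈ ({1, 2} : Finset (ZMod 5)), a1 * t1 ^ 2 + a2 * t2 ^ 2 + a3 * t3 ^ 2 = c := by
      set_option maxRecDepth 100000 in decide
    obtain ⟨t1, h1, t2, h2, t3, h3, h⟩ := key a1 a2 a3 c (by simpa using ha1) (by simpa using ha2)
      (by simpa using ha3) (by simpa using hc0)
    have hn : ∀ t ∈ ({1, 2} : Finset (ZMod 5)), t ≠ 0 := by decide
    refine ⟨e t1, e t2, e t3, by simpa using hn _ h1, by simpa using hn _ h2,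
      by simpa using hn _ h3, ?_⟩
    simp only [← map_pow, ← map_mul, ← map_add, h]
  obtain ⟨t1, t2, t3, h1, h2, h3, rfl⟩ := this
  exact UU_comb (hp.mul hq) hr c1 (UU_comb hp hq c2 (UU_scale h1 hU1) (UU_scale h2 hU2))
    (UU_scale h3 hU3)

lemma five (h2 : (2 : E) ≠ 0) (e : ZMod 5 ≃+* E) {f : E[X]} (hf : f.Monic) (hs : Squarefree f)
    (hd : 3 ≤ f.natDegree) : TT f := by
  have hE : ∀ w0 w1 c : E, w0 ≠ 0 → w1 ≠ 0 → c ≠ 0 → ∃ a b, w0 * a ^ 2 + w1 * b ^ 2 = c := by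
    intro w0 w1 c h0 h1 hc
    obtain ⟨c, rfl⟩ := e.surjective c
    obtain ⟨w0, rfl⟩ := e.surjective w0
    obtain ⟨w1, rfl⟩ := e.surjective w1
    have key : ∀ w0 w1 c : ZMod 5, w0 ≠ 0 → w1 ≠ 0 → c ≠ 0 →
      ∃ a b, w0 * a ^ 2 + w1 * b ^ 2 = c := by set_option maxRecDepth 100000 in decide
    obtain ⟨a, b, h⟩ := key w0 w1 c (by simpa using h0) (by simpa using h1) (by simpa using hc)
    exact ⟨e a, e b, by simp only [← map_pow, ← map_mul, ← map_add, h]⟩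
  have step : ∀ p q : E[X], p.Monic → q.Monic → Irreducible p → f = p * q → 2 ≤ p.natDegree →
      TT f := by
    rintro p q hp hq hi rfl hd
    exact T_mul5 h2 e hp hq hs (T_irr h2 hE hp hi hd)
  obtain ⟨p, f1, hp, hf1, ip, rfl⟩ := exfac hf (by omega)
  have e1 := hp.natDegree_mul hf1
  by_cases d1 : 2 ≤ p.natDegree
  · exact step p f1 hp hf1 ip rfl d1
  obtain ⟨q, f2, hq, hf2, iq, rfl⟩ := exfac hf1 (by omega)
  have e2 := hq.natDegree_mul hf2
  by_cases d2 : 2 ≤ q.natDegree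
  · exact step q (p * f2) hq (hp.mul hf2) iq (by ring) d2
  obtain ⟨r, f3, hr, hf3, ir, rfl⟩ := exfac hf2 (by omega)
  have e3 : p * (q * (r * f3)) = (p * q * r) * f3 := by ring
  rw [e3] at hs ⊢
  exact T_mul5 h2 e ((hp.mul hq).mul hr) hf3 hs (three5 h2 e hp hq hr ip iq ir (sq_cop hs).2.1)

lemma tri (h2 : (2 : E) ≠ 0) :
    (∀ c : E, c ≠ 0 → ∃ a b : E, a ≠ 0 ∧ b ≠ 0 ∧ a ^ 2 + c * b ^ 2 = 1) ∨
      Nonempty (ZMod 3 ≃+* E) ∨ Nonempty (ZMod 5 ≃+* E) := by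
  classical
  by_cases hcon : ∀ c : E, c ≠ 0 → ∃ t : E, t ≠ 0 ∧ c * t ^ 2 ≠ 1 ∧ c * t ^ 2 ≠ -1
  · left
    intro c hc
    obtain ⟨t, ht, h1, h3⟩ := hcon c hc
    have hd : 1 + c * t ^ 2 ≠ 0 := fun h => h3 (by linear_combination h)
    have hn : 1 - c * t ^ 2 ≠ 0 := fun h => h1 (by linear_combination -h)
    refine ⟨(1 - c * t ^ 2) / (1 + c * t ^ 2), 2 * t / (1 + c * t ^ 2), div_ne_zero hn hd,
      div_ne_zero (mul_ne_zero h2 ht) hd, ?_⟩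
    field_simp
    ring
  · right
    push Not at hcon
    obtain ⟨c, hc, h⟩ := hcon
    let P : E[X] := C (c ^ 2) * X ^ 5 - X
    have hdeg : P.natDegree ≤ 5 := by
      simp only [P]; compute_degree
    have hP0 : P ≠ 0 := by
      intro h0
      have : P.coeff 1 = 0 := by rw [h0]; simp
      simp only [P, coeff_sub, coeff_C_mul, coeff_X_pow, coeff_X] at this
      norm_num at this
    have hroot : ∀ t : E, t ∈ P.roots.toFinset := by
      intro t
      rw [Multiset.mem_toFinset, mem_roots hP0]
      simp only [IsRoot.def, P, eval_sub, eval_mul, eval_C, eval_pow, eval_X]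
      by_cases ht : t = 0
      · simp [ht]
      · by_cases h1 : c * t ^ 2 = 1
        · linear_combination t * (c * t ^ 2 + 1) * h1
        · linear_combination t * (c * t ^ 2 - 1) * h t ht h1
    have : Fintype E := ⟨P.roots.toFinset, hroot⟩
    have hcard : Fintype.card E ≤ 5 := by
      calc Fintype.card E ≤ P.roots.toFinset.card :=
            Finset.card_le_card (fun t _ => hroot t)
        _ ≤ P.roots.card := Multiset.toFinset_card_le _
        _ ≤ P.natDegree := card_roots' P
        _ ≤ 5 := hdeg
    have h1 : 1 < Fintype.card E := Fintype.one_lt_card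
    have h0 : ((Fintype.card E : ℕ) : E) = 0 := FiniteField.cast_card_eq_zero E
    generalize hk : Fintype.card E = k at *
    interval_cases k
    · exact absurd h0 (by exact_mod_cast h2)
    · exact Or.inl ⟨ZMod.ringEquivOfPrime E (by norm_num) hk⟩
    · exfalso
      have : (2 : E) * 2 = 0 := by push_cast at h0; linear_combination h0
      simp [h2] at this
    · exact Or.inr ⟨ZMod.ringEquivOfPrime E (by norm_num) hk⟩

lemma lin_form {l : E[X]} (hl : l.Monic) (hd : l.natDegree = 1) : ∃ a, l = X - C a := by
  refine ⟨-l.coeff 0, ?_⟩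
  have := hl.eq_X_add_C hd
  rw [C_neg, sub_neg_eq_add]; exact this

lemma UU_lin {a c : E} {G : E[X]} (h : UU (X - C a) G c) : ∃ t, G.eval a * t ^ 2 = c := by
  obtain ⟨x, -, rfl⟩ := h
  refine ⟨x.eval a, ?_⟩
  rw [Qv, LL_apply, modByMonic_X_sub_C_eq_C_eval, natDegree_X_sub_C, coeff_C_zero, eval_mul,
    eval_pow]

lemma cop_ne {a b : E} (h : IsCoprime (X - C a : E[X]) (X - C b)) : a ≠ b := by
  rintro rfl
  exact not_isUnit_X_sub_C a (isCoprime_self.1 h)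

lemma three (h2 : (2 : E) ≠ 0) (e : ZMod 3 ≃+* E) {f g : E[X]} (hf : f.Monic) (hs : Squarefree f)
    (hc : IsCoprime f g) (hd : 3 ≤ f.natDegree) : Concl f g := by
  have h3 : (3 : E) = 0 := by
    have : (3 : ZMod 3) = 0 := by decide
    have h := map_ofNat e 3
    have h' : e 3 = 0 := by rw [this, map_zero]
    exact h.symm.trans h'
  have hel : ∀ c : E, c ≠ 0 → c ≠ 1 → c = -1 := by
    intro c h0 h1
    obtain ⟨c, rfl⟩ := e.surjective c
    have key : ∀ c : ZMod 3, c ≠ 0 → c ≠ 1 → c = -1 := by decide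
    rw [key c (by simpa using h0) (by simpa using h1)]; simp
  have h4 : ∀ a b c d : E, a ≠ b → a ≠ c → a ≠ d → b ≠ c → b ≠ d → c ≠ d → False := by
    intro a b c d
    obtain ⟨a, rfl⟩ := e.surjective a
    obtain ⟨b, rfl⟩ := e.surjective b
    obtain ⟨c, rfl⟩ := e.surjective c
    obtain ⟨d, rfl⟩ := e.surjective d
    simp only [e.injective.ne_iff]
    have key : ∀ a b c d : ZMod 3, a = b ∨ a = c ∨ a = d ∨ b = c ∨ b = d ∨ c = d := by decide
    have := key a b c d
    tauto
  have hv : ∀ a b c y t : E, a ≠ b → a ≠ c → b ≠ c → y * ((a - b) * (a - c)) * t ^ 2 = -1 → y = 1 := by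
    intro a b c y t
    obtain ⟨a, rfl⟩ := e.surjective a
    obtain ⟨b, rfl⟩ := e.surjective b
    obtain ⟨c, rfl⟩ := e.surjective c
    obtain ⟨y, rfl⟩ := e.surjective y
    obtain ⟨t, rfl⟩ := e.surjective t
    have key : ∀ a b c y t : ZMod 3, a ≠ b → a ≠ c → b ≠ c →
      y * ((a - b) * (a - c)) * t ^ 2 = -1 → y = 1 := by set_option maxRecDepth 100000 in decide
    have e1 : (-1 : E) = e (-1) := by simp
    rw [e1]
    simp only [e.injective.ne_iff, ← map_pow, ← map_mul, ← map_sub, e.injective.eq_iff]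
    intro x1 x2 x3 x4
    rw [key a b c y t x1 x2 x3 x4, map_one]
  have hE : ∀ w0 w1 c : E, w0 ≠ 0 → w1 ≠ 0 → c ≠ 0 → ∃ a b, w0 * a ^ 2 + w1 * b ^ 2 = c := by
    intro w0 w1 c h0 h1 hc
    obtain ⟨c, rfl⟩ := e.surjective c
    obtain ⟨w0, rfl⟩ := e.surjective w0
    obtain ⟨w1, rfl⟩ := e.surjective w1
    have key : ∀ w0 w1 c : ZMod 3, w0 ≠ 0 → w1 ≠ 0 → c ≠ 0 →
      ∃ a b, w0 * a ^ 2 + w1 * b ^ 2 = c := by set_option maxRecDepth 100000 in decide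
    obtain ⟨a, b, h⟩ := key w0 w1 c (by simpa using h0) (by simpa using h1) (by simpa using hc)
    exact ⟨e a, e b, by simp only [← map_pow, ← map_mul, ← map_add, h]⟩
  have hT : ∀ p : E[X], p.Monic → Irreducible p → 2 ≤ p.natDegree → TT p :=
    fun p hp hi hd => T_irr h2 hE hp hi hd
  by_cases hL : ∃ P l : E[X], P.Monic ∧ l.Monic ∧ l.natDegree = 1 ∧ f = P * l ∧ UU l (g * P) 1
  · obtain ⟨P, l, hP, hl, hd1, rfl, hU⟩ := hL
    exact finL hP hl hd1 (sq_cop hs).2.1 hU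
  have hneg : ∀ (P : E[X]) (a : E), P.Monic → f = (X - C a) * P → UU (X - C a) (g * P) (-1) := by
    intro P a hP hfe
    have hs' := hs
    have hc' := hc
    rw [hfe] at hs' hc'
    obtain ⟨c, hc0, hU⟩ := nz h2 (monic_X_sub_C a) (irreducible_X_sub_C a)
      (hc'.of_mul_left_left.mul_right (sq_cop hs').1)
    have : c ≠ 1 := by
      rintro rfl
      exact hL ⟨P, X - C a, hP, monic_X_sub_C a, natDegree_X_sub_C a, by rw [hfe, mul_comm], hU⟩
    rwa [hel c hc0 this] at hU
  have hab : ∀ (a b : E) (P : E[X]), f = (X - C a) * ((X - C b) * P) → a ≠ b := by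
    intro a b P hfe
    rw [hfe] at hs
    exact cop_ne (sq_cop hs).1.of_mul_right_left
  have hab4 : ∀ (a b c d : E) (P : E[X]),
      f ≠ (X - C a) * ((X - C b) * ((X - C c) * ((X - C d) * P))) := by
    intro a b c d P hfe
    refine h4 a b c d (hab a b _ hfe) (hab a c ((X - C b) * ((X - C d) * P)) ?_)
      (hab a d ((X - C b) * ((X - C c) * P)) ?_) (hab b c ((X - C a) * ((X - C d) * P)) ?_)
      (hab b d ((X - C a) * ((X - C c) * P)) ?_) (hab c d ((X - C a) * ((X - C b) * P)) ?_) <;>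
    (rw [hfe]; ring)
  have pull : ∀ q : E[X], q.Monic → (∀ p r : E[X], p.Monic → r.Monic → Irreducible p → q = p * r →
      ¬ 2 ≤ p.natDegree) → q = 1 ∨ ∃ (a : E) (r : E[X]), r.Monic ∧ q = (X - C a) * r ∧
      (∀ p r' : E[X], p.Monic → r'.Monic → Irreducible p → r = p * r' → ¬ 2 ≤ p.natDegree) := by
    intro q hq hl
    by_cases hd0 : q.natDegree = 0
    · exact Or.inl (eq_one_of_monic_natDegree_zero hq hd0)
    · right
      obtain ⟨p, r, hp, hr, ip, rfl⟩ := exfac hq (by omega)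
      have := hl p r hp hr ip rfl
      have := ip.natDegree_pos
      obtain ⟨a, rfl⟩ := lin_form hp (by omega)
      refine ⟨a, r, hr, rfl, ?_⟩
      rintro p' r' hp' hr' ip' rfl
      exact hl p' ((X - C a) * r') hp' ((monic_X_sub_C a).mul hr') ip' (by ring)
  have M := fun a : E => monic_X_sub_C a
  by_cases hA : ∃ p q : E[X], p.Monic ∧ q.Monic ∧ Irreducible p ∧ f = p * q ∧ 2 ≤ p.natDegree
  · obtain ⟨p, q, hp, hq, ip, rfl, hpd⟩ := hA
    have Tp := hT p hp ip hpd
    obtain ⟨cpq, -, sq⟩ := sq_cop hs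
    have cpg := hc.of_mul_left_left
    have cqg := hc.of_mul_left_right
    have fin : ∀ c : E, c ≠ 1 → UU q (g * p) c → Concl (p * q) g := by
      intro c hc1 hU
      refine finU hf (by omega) hc ?_
      have := UU_comb hp hq cpq (Tp (g * q) (cpg.mul_right cpq) (1 - c) (sub_ne_zero.2 hc1.symm)) hU
      simpa using this
    by_cases hA1 : ∃ p' q' : E[X], p'.Monic ∧ q'.Monic ∧ Irreducible p' ∧ q = p' * q' ∧
      2 ≤ p'.natDegree
    · obtain ⟨p', q', hp', hq', ip', rfl, hpd'⟩ := hA1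
      have Tp' := hT p' hp' ip' hpd'
      obtain ⟨c', -, sq'⟩ := sq_cop sq
      obtain ⟨c, hU⟩ := anyU h2 _ q' (g * p * p') rfl hq' sq'
        ((cqg.of_mul_left_right.mul_right cpq.of_mul_right_right.symm).mul_right c'.symm)
      have : ∃ b : E, b ≠ 0 ∧ b + c ≠ 1 := by
        by_cases h : 1 + c = 1
        · refine ⟨-1, by simp, fun h' => h2 ?_⟩
          linear_combination h - h'
        · exact ⟨1, one_ne_zero, h⟩
      obtain ⟨b, hb, hbc⟩ := this
      exact fin _ hbc (UU_comb hp' hq' c' (Tp' (g * p * q')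
        ((cqg.of_mul_left_left.mul_right cpq.of_mul_right_left.symm).mul_right c') b hb) hU)
    · have hq0 : ∀ p r : E[X], p.Monic → r.Monic → Irreducible p → q = p * r →
          ¬ 2 ≤ p.natDegree := fun p' r x1 x2 x3 x4 x5 => hA1 ⟨p', r, x1, x2, x3, x4, x5⟩
      rcases pull q hq hq0 with rfl | ⟨a, q1, hq1, rfl, hl1⟩
      · exact fin 0 (by simp) ⟨1, isCoprime_one_left, LL_dvd monic_one (one_dvd _)⟩
      have Na := hneg (p * q1) a (hp.mul hq1) (by ring)
      rw [← mul_assoc] at Na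
      rcases pull q1 hq1 hl1 with rfl | ⟨b, q2, hq2, rfl, hl2⟩
      · refine fin (-1) (fun h => h2 (by linear_combination -h)) ?_
        simpa using Na
      have Nb := hneg (p * (X - C a) * q2) b ((hp.mul (M a)).mul hq2) (by ring)
      rw [← mul_assoc, ← mul_assoc] at Nb
      have cab := (sq_cop sq).1
      rcases pull q2 hq2 hl2 with rfl | ⟨c, q3, hq3, rfl, hl3⟩
      · simp only [mul_one] at *
        obtain ⟨v, -, hv1⟩ := UU_comb (M a) (M b) cab Na Nb
        refine finR (v := v) hp ((M a).mul (M b)) ?_ ip hpd ?_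
        · rw [(M a).natDegree_mul (M b)]; simp
        · rw [hv1]; linear_combination -h3
      have Nc := hneg (p * (X - C a) * (X - C b) * q3) c (((hp.mul (M a)).mul (M b)).mul hq3)
        (by ring)
      rw [← mul_assoc, ← mul_assoc, ← mul_assoc] at Nc
      rcases pull q3 hq3 hl3 with rfl | ⟨d, q4, hq4, rfl, hl4⟩
      · simp only [mul_one] at *
        have cbc := (sq_cop (sq_cop sq).2.2).1
        have hbc : UU ((X - C b) * (X - C c)) (g * p * (X - C a)) (-1 + -1) := UU_comb (M b) (M c) cbc Nb Nc
        refine fin _ ?_ (UU_comb (M a) ((M b).mul (M c)) cab Na hbc)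
        intro h
        have : (1 : E) = 0 := by linear_combination -h - h3
        exact one_ne_zero this
      · exact (hab4 a b c d (p * q4) (by ring)).elim
  · have hq0 : ∀ p r : E[X], p.Monic → r.Monic → Irreducible p → f = p * r →
          ¬ 2 ≤ p.natDegree := fun p' r x1 x2 x3 x4 x5 => hA ⟨p', r, x1, x2, x3, x4, x5⟩
    rcases pull f hf hq0 with rfl | ⟨a, q1, hq1, rfl, hl1⟩
    · simp at hd
    rcases pull q1 hq1 hl1 with rfl | ⟨b, q2, hq2, rfl, hl2⟩
    · simp at hd
    rcases pull q2 hq2 hl2 with rfl | ⟨c, q3, hq3, rfl, hl3⟩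
    · rw [mul_one, (M a).natDegree_mul (M b)] at hd; simp at hd
    rcases pull q3 hq3 hl3 with rfl | ⟨d, q4, hq4, rfl, hl4⟩
    · simp only [mul_one] at *
      have nab := hab a b (X - C c) rfl
      have nac := hab a c (X - C b) (by ring)
      have nbc := hab b c (X - C a) (by ring)
      obtain ⟨t1, ht1⟩ := UU_lin (hneg ((X - C b) * (X - C c)) a ((M b).mul (M c)) rfl)
      obtain ⟨t2, ht2⟩ := UU_lin (hneg ((X - C a) * (X - C c)) b ((M a).mul (M c)) (by ring))
      obtain ⟨t3, ht3⟩ := UU_lin (hneg ((X - C a) * (X - C b)) c ((M a).mul (M b)) (by ring))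
      simp only [eval_mul, eval_sub, eval_X, eval_C] at ht1 ht2 ht3
      have g1 := hv a b c _ _ nab nac nbc ht1
      have g2 := hv b a c _ _ nab.symm nbc nac ht2
      have g3 := hv c a b _ _ nac.symm nbc.symm nab ht3
      have hdv : ∀ z, g.eval z = 1 → (X - C z) ∣ g - 1 := by
        intro z hz
        rw [dvd_iff_isRoot]; simp [hz]
      refine ⟨1, monic_one, squarefree_one, by simp; omega, ?_, 1, ?_⟩
      · rw [(M a).natDegree_mul ((M b).mul (M c)), (M b).natDegree_mul (M c)]; simp
      · rw [mul_one, one_pow]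
        obtain ⟨k1, -, k2⟩ := sq_cop hs
        exact k1.mul_dvd (hdv a g1) ((sq_cop k2).1.mul_dvd (hdv b g2) (hdv c g3))
    · exact (hab4 a b c d q4 rfl).elim

end

theorem statement15 (E : Type*) [Field E] (hchar : ringChar E ≠ 2)
    (f g : Polynomial E) (hmonic : f.Monic) (hsf : Squarefree f)
    (hcop : IsCoprime f g)
    (hu : ∀ (n : ℕ) (a : Fin n → E), (∀ i, a i ≠ 0) → f.natDegree < n → IsotropicDiag a) :
    ∃ gs : Polynomial E, gs.Monic ∧ Squarefree gs ∧
      gs.natDegree < f.natDegree ∧ gs.natDegree % 2 = (f.natDegree - 1) % 2 ∧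
      ∃ s : Polynomial E, f ∣ g * gs - s ^ 2 := by
  have h2 : (2 : E) ≠ 0 := Ring.two_ne_zero hchar
  change Concl f g
  obtain ⟨v, hv⟩ := rep1 h2 hmonic hcop hu
  have hpos : 0 < f.natDegree := by
    by_contra h
    obtain ⟨x, hx, h0⟩ := hu 1 ![1] (by simp) (by omega)
    apply hx
    funext i
    fin_cases i
    simpa using h0
  have small : (∀ a b : E, a ^ 2 = 2 * b ^ 2 → a = 0 ∧ b = 0) → 2 ≤ f.natDegree := by
    intro hsm
    by_contra h
    obtain ⟨x, hx, h0⟩ := hu 2 ![1, -2] (by intro i; fin_cases i <;> simp [h2]) (by omega)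
    simp only [Fin.sum_univ_two, Matrix.cons_val_zero, Matrix.cons_val_one] at h0
    have := hsm (x 0) (x 1) (by linear_combination h0)
    apply hx
    funext i
    fin_cases i
    · exact this.1
    · exact this.2
  rcases tri h2 with hbig | ⟨⟨e⟩⟩ | ⟨⟨e⟩⟩
  · exact finU hmonic hpos hcop (bigConcl h2 hbig hmonic hsf hcop hv)
  · have hd2 := small (by
      intro a b h
      obtain ⟨a, rfl⟩ := e.surjective a
      obtain ⟨b, rfl⟩ := e.surjective b
      have key : ∀ a b : ZMod 3, a ^ 2 = 2 * b ^ 2 → a = 0 ∧ b = 0 := by decide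
      have := key a b (e.injective (by
        rw [map_pow, map_mul, map_pow, h]; congr 1; exact (map_ofNat e 2).symm))
      simpa using this)
    by_cases hd : f.natDegree = 2
    · exact finD2 hmonic hd hv
    · exact three h2 e hmonic hsf hcop (by omega)
  · have hd2 := small (by
      intro a b h
      obtain ⟨a, rfl⟩ := e.surjective a
      obtain ⟨b, rfl⟩ := e.surjective b
      have key : ∀ a b : ZMod 5, a ^ 2 = 2 * b ^ 2 → a = 0 ∧ b = 0 := by decide
      have := key a b (e.injective (by
        rw [map_pow, map_mul, map_pow, h]; congr 1; exact (map_ofNat e 2).symm))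
      simpa using this)
    by_cases hd : f.natDegree = 2
    · exact finD2 hmonic hd hv
    · exact finU hmonic hpos hcop
        (five h2 e hmonic hsf (by omega) g hcop 1 one_ne_zero)
end

section
/- Let E be a field of characteristic different from 2 and let f ∈ E[X] be square-free of even degree with leading coefficient not a square in E. If the affine curve Y² = f(X) has a point of odd degree over E, then it has a point of odd degree at most deg(f)/2 over E. -/
open Polynomial

/-- The affine curve `Y² = f(X)` has a point of odd degree `d` over `E`:
there are `x`, `y` algebraic over `E` with `y² = f(x)` and `[E(x,y):E] = d` odd. -/
def HasOddDegreePointOfDegree (E : Type*) [Field E] (f : Polynomial E) (d : ℕ) : Prop :=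
  Odd d ∧ ∃ x y : AlgebraicClosure E, y ^ 2 = aeval x f ∧
    Module.finrank E ↥(Algebra.adjoin E ({x, y} : Set (AlgebraicClosure E))) = d

open IntermediateField

lemma norm_lem {E : Type*} [Field E] (f A B : E[X]) (m s : ℕ) (hf : f.natDegree = 2 * m)
    (hlc : ¬ IsSquare f.leadingCoeff) (hA : A.natDegree ≤ s) (hB : B = 0 ∨ B.natDegree + m ≤ s)
    (h0 : A ≠ 0 ∨ B ≠ 0) :
    A ^ 2 - f * B ^ 2 ≠ 0 ∧ Even (A ^ 2 - f * B ^ 2).natDegree ∧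
      (A ^ 2 - f * B ^ 2).natDegree ≤ 2 * s := by
  have hf0 : f ≠ 0 := by
    rintro rfl
    exact hlc ⟨0, by simp⟩
  by_cases hB0 : B = 0
  · subst hB0
    have hA0 : A ≠ 0 := by simpa using h0
    refine ⟨by simpa using hA0, by simp, ?_⟩
    simp only [natDegree_pow, ne_eq, OfNat.ofNat_ne_zero, not_false_eq_true, zero_pow, mul_zero, sub_zero]
    omega
  have hBs : B.natDegree + m ≤ s := by tauto
  have hd : (f * B ^ 2).natDegree = 2 * (m + B.natDegree) := by
    rw [natDegree_mul hf0 (pow_ne_zero _ hB0), natDegree_pow, hf]; ring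
  have hdA : (A ^ 2).natDegree = 2 * A.natDegree := by rw [natDegree_pow]
  have hfB : f * B ^ 2 ≠ 0 := mul_ne_zero hf0 (pow_ne_zero _ hB0)
  by_cases hA0 : A = 0
  · subst hA0
    refine ⟨by simpa using hfB, ?_, ?_⟩
    · simp only [ne_eq, OfNat.ofNat_ne_zero, not_false_eq_true, zero_pow, zero_sub, natDegree_neg, hd]
      simp
    · simp only [ne_eq, OfNat.ofNat_ne_zero, not_false_eq_true, zero_pow, zero_sub, natDegree_neg, hd]
      omega
  have key : (A ^ 2 - f * B ^ 2).coeff (2 * max A.natDegree (m + B.natDegree)) ≠ 0 := by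
    rw [coeff_sub]
    rcases lt_trichotomy A.natDegree (m + B.natDegree) with h | h | h
    · rw [max_eq_right h.le, coeff_eq_zero_of_natDegree_lt (by omega), ← hd, zero_sub, neg_ne_zero]
      simpa using hfB
    · rw [← h, max_self]
      nth_rw 2 [h]
      rw [← hdA, ← hd, coeff_natDegree, coeff_natDegree, leadingCoeff_pow, leadingCoeff_mul,
        leadingCoeff_pow]
      intro e
      have hb : B.leadingCoeff ≠ 0 := by simpa using hB0
      apply hlc
      refine ⟨A.leadingCoeff / B.leadingCoeff, ?_⟩
      field_simp
      linear_combination -e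
    · rw [max_eq_left h.le, coeff_eq_zero_of_natDegree_lt (p := f * B ^ 2) (by omega), ← hdA, sub_zero]
      simpa using hA0
  have hle : (A ^ 2 - f * B ^ 2).natDegree ≤ 2 * max A.natDegree (m + B.natDegree) := by
    refine (natDegree_sub_le _ _).trans ?_
    rw [hd, hdA]; omega
  have heq := le_antisymm hle (le_natDegree_of_ne_zero key)
  refine ⟨fun h => key (by rw [h]; simp), ?_, ?_⟩
  · rw [heq]; simp
  · rw [heq]; omega

lemma odd_factor {E : Type*} [Field E] (q : E[X]) (hq : Odd q.natDegree) :
    ∃ p, Irreducible p ∧ p ∣ q ∧ Odd p.natDegree := by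
  induction q using WfDvdMonoid.induction_on_irreducible with
  | zero => simp at hq
  | unit u hu => rw [natDegree_eq_zero_of_isUnit hu] at hq; simp at hq
  | mul a i ha hi ih =>
    by_cases h : Odd i.natDegree
    · exact ⟨i, hi, dvd_mul_right _ _, h⟩
    · rw [natDegree_mul hi.ne_zero ha, Nat.odd_add'] at hq
      rw [Nat.not_odd_iff_even] at h
      obtain ⟨p, h1, h2, h3⟩ := ih (hq.2 h)
      exact ⟨p, h1, h2.mul_left _, h3⟩

lemma exists_AB {E L : Type*} [Field E] [Field L] [Algebra E L] (K : IntermediateField E L)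
    [FiniteDimensional E K] (x y : L) (hx : x ∈ K) (hy : y ∈ K) (a b : ℕ)
    (h : Module.finrank E K < a + b) :
    ∃ A B : E[X], (A ≠ 0 ∨ B ≠ 0) ∧ A.degree < a ∧ B.degree < b ∧ aeval x A = aeval x B * y := by
  let φ : (Fin a → E) × (Fin b → E) →ₗ[E] K :=
    (((aeval (⟨x, hx⟩ : K)).toLinearMap ∘ₗ (degreeLT E a).subtype) ∘ₗ (degreeLTEquiv E a).symm.toLinearMap).coprod
     ((LinearMap.mulRight E (⟨y, hy⟩ : K)) ∘ₗ ((aeval (⟨x, hx⟩ : K)).toLinearMap ∘ₗ (degreeLT E b).subtype) ∘ₗ (degreeLTEquiv E b).symm.toLinearMap)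
  have hk : LinearMap.ker φ ≠ ⊥ := LinearMap.ker_ne_bot_of_finrank_lt (by simpa using h)
  obtain ⟨⟨v, w⟩, hv, h0⟩ := Submodule.exists_mem_ne_zero_of_ne_bot hk
  refine ⟨(degreeLTEquiv E a).symm v, -(degreeLTEquiv E b).symm w, ?_, ?_, ?_, ?_⟩
  · by_contra! hc
    apply h0
    have h1 := hc.1
    have h2 := neg_eq_zero.1 hc.2
    simp only [ZeroMemClass.coe_eq_zero, LinearEquiv.map_eq_zero_iff] at h1 h2
    simp [h1, h2]
  · exact mem_degreeLT.1 ((degreeLTEquiv E a).symm v).2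
  · rw [degree_neg]; exact mem_degreeLT.1 ((degreeLTEquiv E b).symm w).2
  · have := congrArg (algebraMap K L) (LinearMap.mem_ker.1 hv)
    simp only [φ, LinearMap.coprod_apply, LinearMap.comp_apply, map_add, map_zero, LinearMap.mulRight_apply, map_mul,
      AlgHom.toLinearMap_apply, LinearEquiv.coe_coe, Submodule.subtype_apply, ← aeval_algebraMap_apply] at this
    rw [map_neg]
    simp only [IntermediateField.algebraMap_apply] at this
    linear_combination this

lemma adj_eq {E : Type*} [Field E] (x y : AlgebraicClosure E) :
    Module.finrank E ↥(Algebra.adjoin E ({x, y} : Set (AlgebraicClosure E))) =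
      Module.finrank E E⟮x, y⟯ := by
  rw [← IntermediateField.adjoin_toSubalgebra_of_isAlgebraic]
  · rfl
  · intro z _; exact Algebra.IsAlgebraic.isAlgebraic z

lemma adj_of_mem {E : Type*} [Field E] (x y : AlgebraicClosure E) (hy : y ∈ E⟮x⟯) :
    E⟮x, y⟯ = E⟮x⟯ := by
  apply le_antisymm
  · rw [IntermediateField.adjoin_le_iff]
    rintro z (rfl | rfl)
    · exact mem_adjoin_simple_self E _
    · exact hy
  · exact IntermediateField.adjoin.mono _ _ _ (by simp)

lemma mem_of_odd {E : Type*} [Field E] (f : E[X]) (x y : AlgebraicClosure E) (h : y ^ 2 = aeval x f)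
    (ho : Odd (Module.finrank E E⟮x, y⟯)) : y ∈ E⟮x⟯ := by
  have hi : IsIntegral E⟮x⟯ y := (Algebra.IsAlgebraic.isAlgebraic (R := E) y).isIntegral.tower_top
  have h1 : Module.finrank E E⟮x, y⟯ = Module.finrank E E⟮x⟯ * Module.finrank E⟮x⟯ E⟮x⟯⟮y⟯ := by
    rw [Module.finrank_mul_finrank, ← adjoin_simple_adjoin_simple]
    rfl
  rw [h1, adjoin.finrank hi, Nat.odd_mul] at ho
  have h2 : minpoly E⟮x⟯ y ∣ X ^ 2 - C (aeval (AdjoinSimple.gen E x) f) := by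
    apply minpoly.dvd
    simp only [map_sub, map_pow, aeval_X, aeval_C, ← aeval_algebraMap_apply, AdjoinSimple.algebraMap_gen, h, sub_self]
  have h3 := natDegree_le_of_dvd h2 (X_pow_sub_C_ne_zero (by norm_num) _)
  rw [natDegree_X_pow_sub_C] at h3
  have h4 : (minpoly E⟮x⟯ y).natDegree = 1 := by
    obtain ⟨k, hk⟩ := ho.2
    omega
  have h5 := minpoly.mem_range_of_degree_eq_one E⟮x⟯ y (by rw [degree_eq_natDegree (minpoly.ne_zero hi), h4]; rfl)
  obtain ⟨z, rfl⟩ := h5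
  exact z.2

lemma aeval_mem_adj {E L : Type*} [Field E] [Field L] [Algebra E L] (z : L) (P : E[X]) :
    aeval z P ∈ E⟮z⟯ := by
  have h := aeval_algebraMap_apply L (AdjoinSimple.gen E z) P
  rw [AdjoinSimple.algebraMap_gen] at h
  rw [h]
  exact (aeval (AdjoinSimple.gen E z) P).2

lemma gcd_lem {E : Type*} [Field E] (A B : E[X]) (hBne : B ≠ 0) :
    ∃ h A1 B1 : E[X], IsCoprime A1 B1 ∧ A = h * A1 ∧ B = h * B1 := by
  classical
  obtain ⟨A1, hA1⟩ := EuclideanDomain.gcd_dvd_left A B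
  obtain ⟨B1, hB1⟩ := EuclideanDomain.gcd_dvd_right A B
  have hb := EuclideanDomain.gcd_eq_gcd_ab A B
  have hg : EuclideanDomain.gcd A B ≠ 0 := fun h => hBne (EuclideanDomain.gcd_eq_zero_iff.1 h).2
  generalize EuclideanDomain.gcd A B = g at *
  generalize EuclideanDomain.gcdA A B = u at *
  generalize EuclideanDomain.gcdB A B = v at *
  refine ⟨g, A1, B1, ⟨u, v, ?_⟩, hA1, hB1⟩
  apply mul_left_cancel₀ hg
  rw [hA1, hB1] at hb
  linear_combination -hb

lemma core_lem {E L : Type*} [Field E] [Field L] [Algebra E L] (f : E[X]) (m d : ℕ)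
    (hm : f.natDegree = m + m) (hlc : ¬ IsSquare f.leadingCoeff) (hd : Odd d) (hdm : m < d)
    (x y : L) (hxy : y ^ 2 = aeval x f) (hy : y ∈ E⟮x⟯)
    (hfin : Module.finrank E E⟮x⟯ = d) (hix : IsIntegral E x) :
    ∃ r A1 B1 : E[X], Irreducible r ∧ Odd r.natDegree ∧ r.natDegree ≤ m ∧ IsCoprime A1 B1 ∧
      r ∣ A1 ^ 2 - f * B1 ^ 2 := by
  have hp := adjoin.finrank hix
  rw [hfin] at hp
  have : FiniteDimensional E E⟮x⟯ := adjoin.finiteDimensional hix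
  obtain ⟨s, hs⟩ : ∃ s, s = (d + m) / 2 := ⟨_, rfl⟩
  obtain ⟨A, B, h0, hA, hB, hAB⟩ := exists_AB E⟮x⟯ x y (mem_adjoin_simple_self E x) hy
    (s + 1) (s - m + 1) (by rw [hfin]; obtain ⟨k, hk⟩ := hd; omega)
  have hA' : A.natDegree ≤ s := by
    exact natDegree_le_iff_coeff_eq_zero.2 fun N hN => (degree_lt_iff_coeff_zero A _).1 hA N hN
  have hB' : B.natDegree ≤ s - m := by
    exact natDegree_le_iff_coeff_eq_zero.2 fun N hN => (degree_lt_iff_coeff_zero B _).1 hB N hN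
  clear hA hB
  have hBne : B ≠ 0 := by
    rintro rfl
    have hA0 : A ≠ 0 := by simpa using h0
    have := natDegree_le_of_dvd (minpoly.dvd E x (p := A) (by simpa using hAB)) hA0
    omega
  obtain ⟨h, A1, B1, hcop, hA1, hB1⟩ : ∃ h A1 B1 : E[X], IsCoprime A1 B1 ∧ A = h * A1 ∧ B = h * B1 := gcd_lem A B hBne
  have hh : h ≠ 0 := by rintro rfl; simp at hB1; exact hBne hB1
  have hB10 : B1 ≠ 0 := by rintro rfl; simp at hB1; exact hBne hB1
  have hBd : B.natDegree = h.natDegree + B1.natDegree := by rw [hB1, natDegree_mul hh hB10]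
  have hA1d : A1.natDegree ≤ s := by
    by_cases hz : A1 = 0
    · simp [hz]
    · rw [hA1, natDegree_mul hh hz] at hA'; omega
  have hhx : aeval x h ≠ 0 := by
    intro e
    have := natDegree_le_of_dvd (minpoly.dvd E x e) hh
    omega
  have hAB1 : aeval x A1 = aeval x B1 * y := by
    rw [hA1, hB1, map_mul, map_mul, mul_assoc] at hAB
    exact mul_left_cancel₀ hhx hAB
  obtain ⟨hN0, hNe, hNd⟩ := norm_lem f A1 B1 m s (by omega) hlc hA1d (Or.inr (by omega)) (Or.inr hB10)
  obtain ⟨q, hq⟩ : minpoly E x ∣ A1 ^ 2 - f * B1 ^ 2 := by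
    apply minpoly.dvd
    rw [map_sub, map_mul, map_pow, map_pow, hAB1, ← hxy]; ring
  have hq0 : q ≠ 0 := by rintro rfl; simp at hq; exact hN0 hq
  have hqd : (A1 ^ 2 - f * B1 ^ 2).natDegree = d + q.natDegree := by
    rw [hq, natDegree_mul (minpoly.ne_zero hix) hq0, hp]
  have hqo : Odd q.natDegree := by
    rw [hqd, Nat.even_add'] at hNe
    exact hNe.1 hd
  obtain ⟨r, hri, hrq, hro⟩ := odd_factor q hqo
  have hle := natDegree_le_of_dvd hrq hq0
  exact ⟨r, A1, B1, hri, hro, by omega, hcop, hq ▸ hrq.mul_left _⟩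

lemma tail_lem {E : Type*} [Field E] (f r A1 B1 : E[X]) (hri : Irreducible r)
    (hcop : IsCoprime A1 B1) (hrq : r ∣ A1 ^ 2 - f * B1 ^ 2) :
    ∃ x y : AlgebraicClosure E, y ^ 2 = aeval x f ∧
      Module.finrank E ↥(Algebra.adjoin E ({x, y} : Set (AlgebraicClosure E))) = r.natDegree := by
  obtain ⟨z, hz⟩ := IsAlgClosed.exists_aeval_eq_zero (AlgebraicClosure E) r hri.degree_pos.ne'
  have hiz : IsIntegral E z := (Algebra.IsAlgebraic.isAlgebraic (R := E) z).isIntegral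
  have hrd : (minpoly E z).natDegree = r.natDegree := by
    rw [← minpoly.eq_of_irreducible hri hz, natDegree_mul_C]
    simpa using hri.ne_zero
  have hN : aeval z A1 ^ 2 = aeval z f * aeval z B1 ^ 2 := by
    have : aeval z (A1 ^ 2 - f * B1 ^ 2) = 0 := by
      obtain ⟨t, ht⟩ := hrq
      rw [ht, map_mul, hz, zero_mul]
    simpa [sub_eq_zero] using this
  have hBz : aeval z B1 ≠ 0 := by
    intro e
    have e2 : aeval z A1 = 0 := by simpa [e] using hN
    obtain ⟨u, v, huv⟩ := hcop
    have := congrArg (aeval z) huv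
    simp [e, e2] at this
  have hmem : ∀ P : E[X], aeval z P ∈ E⟮z⟯ := fun P =>
    aeval_mem_adj z P
  refine ⟨z, aeval z A1 / aeval z B1, ?_, ?_⟩
  · rw [div_pow, hN]; field_simp
  · rw [adj_eq, adj_of_mem _ _ (div_mem (hmem _) (hmem _)), adjoin.finrank hiz, hrd]

theorem statement16 (E : Type*) [Field E] (hchar : ringChar E ≠ 2)
    (f : Polynomial E) (hsf : Squarefree f) (heven : Even f.natDegree)
    (hlc : ¬ IsSquare f.leadingCoeff)
    (hpt : ∃ d, HasOddDegreePointOfDegree E f d) :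
    ∃ d, HasOddDegreePointOfDegree E f d ∧ d ≤ f.natDegree / 2 := by
  obtain ⟨d, hd, x, y, hxy, hfin⟩ := hpt
  obtain ⟨m, hm⟩ := heven
  have hm2 : f.natDegree / 2 = m := by omega
  rw [hm2]
  by_cases hdm : d ≤ m
  · exact ⟨d, ⟨hd, x, y, hxy, hfin⟩, hdm⟩
  push Not at hdm
  rw [adj_eq] at hfin
  have hy : y ∈ E⟮x⟯ := mem_of_odd f x y hxy (hfin ▸ hd)
  rw [adj_of_mem x y hy] at hfin
  obtain ⟨r, A1, B1, hri, hro, hle, hcop, hrq⟩ := core_lem f m d hm hlc hd hdm x y hxy hy hfin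
    (Algebra.IsAlgebraic.isAlgebraic (R := E) x).isIntegral
  exact ⟨r.natDegree, ⟨hro, tail_lem f r A1 B1 hri hcop hrq⟩, hle⟩
end

section
/- Let E be a field of characteristic different from 2, let f ∈ E[X] be a nonconstant separable polynomial, and let θ denote the class of X in E_f = E[X]/(f). Assume that (1) the affine curve Y² = f(X) has a point of odd degree over E, and (2) for every unit α of E_f there exists a ∈ E such that θ − a ∈ α·(E_f^×)². Then f is square-reflexive. -/
open Polynomial

/-- `f` is square-reflexive over `E`. -/
def IsSquareReflexive {E : Type*} [Field E] (f : Polynomial E) : Prop :=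
  Squarefree f ∧
  ∀ α : (Polynomial E ⧸ Ideal.span {f})ˣ,
    (∃ u : Eˣ, Algebra.norm E (α : Polynomial E ⧸ Ideal.span {f}) = (u : E) ^ 2 ∨
               Algebra.norm E (α : Polynomial E ⧸ Ideal.span {f}) = f.leadingCoeff * (u : E) ^ 2) →
    ∃ g : Polynomial E, IsCoprime f g ∧
      (∃ β : (Polynomial E ⧸ Ideal.span {f})ˣ,
        Ideal.Quotient.mk (Ideal.span {f}) g
          = (α : Polynomial E ⧸ Ideal.span {f}) * (β : Polynomial E ⧸ Ideal.span {f}) ^ 2) ∧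
      IsSquare (Ideal.Quotient.mk (Ideal.span {g}) f)

/-- The affine curve `Y² = f(X)` has a point of odd degree over `E`:
there are `x`, `y` algebraic over `E` with `y² = f(x)` and `[E(x,y):E]` odd. -/
def HasOddDegreePoint (E : Type*) [Field E] (f : Polynomial E) : Prop :=
  ∃ x y : AlgebraicClosure E, y ^ 2 = aeval x f ∧
    Odd (Module.finrank E ↥(Algebra.adjoin E ({x, y} : Set (AlgebraicClosure E))))


lemma det_aeval_eq_res {n : Type*} [Fintype n] [DecidableEq n] {K : Type*} [Field K] [IsAlgClosed K]
    (A : Matrix n n K) (p : K[X]) : (aeval A p).det = resultant A.charpoly p := by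
  have hn : A.charpoly.natDegree = Fintype.card n := Matrix.charpoly_natDegree_eq_dim A
  have key : ∀ s : Multiset K, (aeval A (s.map (fun r => X - C r)).prod).det
      = resultant A.charpoly (s.map (fun r => X - C r)).prod := by
    intro s
    induction s using Multiset.induction with
    | empty => simp
    | cons a s ih =>
      rw [Multiset.map_cons, Multiset.prod_cons, map_mul, Matrix.det_mul, ih]
      have hd : ((X - C a) * (s.map (fun r => X - C r)).prod).natDegree
          = (X - C a).natDegree + (s.map (fun r => X - C r)).prod.natDegree := by
        refine (monic_X_sub_C a).natDegree_mul (monic_multiset_prod_of_monic _ _ fun i _ => monic_X_sub_C i)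
      rw [hd, resultant_mul_right _ _ _ _ le_rfl]
      congr 1
      rw [natDegree_X_sub_C, resultant_X_sub_C_right _ _ _ le_rfl, hn, Matrix.eval_charpoly,
        ← Matrix.det_neg]
      congr 1
      simp [Matrix.algebraMap_eq_diagonal, Matrix.scalar_apply, Pi.algebraMap_def]
  have hs := (IsAlgClosed.splits p).eq_prod_roots
  by_cases hp : p = 0
  · subst hp
    rcases isEmpty_or_nonempty n with hne | hne
    · simp
    · simp [hn]
  have hd : (p.roots.map (fun r => X - C r)).prod.natDegree = p.natDegree := by
    conv_rhs => rw [hs, natDegree_C_mul (leadingCoeff_ne_zero.2 hp)]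
  have h2 := key p.roots
  rw [hd] at h2
  conv_lhs => rw [hs]
  conv_rhs => rw [show resultant A.charpoly p A.charpoly.natDegree p.natDegree = resultant A.charpoly (C p.leadingCoeff * (p.roots.map (fun r => X - C r)).prod) A.charpoly.natDegree p.natDegree by rw [← hs]]
  rw [resultant_C_mul_right, ← h2, map_mul, Matrix.det_mul, hn, aeval_C, Matrix.algebraMap_eq_diagonal, Matrix.det_diagonal]
  simp

lemma det_aeval_eq_res' {n : Type*} [Fintype n] [DecidableEq n] {E : Type*} [Field E]
    (A : Matrix n n E) (p : E[X]) : (aeval A p).det = resultant A.charpoly p := by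
  apply (algebraMap E (AlgebraicClosure E)).injective
  have := det_aeval_eq_res (A.map (algebraMap E (AlgebraicClosure E))) (p.map (algebraMap E (AlgebraicClosure E)))
  rw [Matrix.charpoly_map, resultant_map_map, natDegree_map, natDegree_map] at this
  rw [← this, RingHom.map_det]
  congr 1
  rw [aeval_map_algebraMap]
  have h := aeval_algHom_apply ((Algebra.ofId E (AlgebraicClosure E)).mapMatrix (m := n)) A p
  exact h.symm

lemma norm_res {E : Type*} [Field E] (f : E[X]) (hf : f ≠ 0) (p : E[X]) :
    Algebra.norm E (Ideal.Quotient.mk (Ideal.span {f}) p) = resultant (f * C f.leadingCoeff⁻¹) p := by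
  let pb := AdjoinRoot.powerBasis hf
  have h1 : Algebra.norm E (AdjoinRoot.mk f p) = resultant (f * C f.leadingCoeff⁻¹) p := by
    rw [Algebra.norm_eq_matrix_det pb.basis, ← AdjoinRoot.aeval_eq, ← AdjoinRoot.powerBasis_gen hf,
      ← aeval_algHom_apply, det_aeval_eq_res', charpoly_leftMulMatrix, AdjoinRoot.powerBasis_gen hf, AdjoinRoot.minpoly_root hf]
  exact h1

lemma finrank_quot {E : Type*} [Field E] (f : E[X]) (hf : f ≠ 0) :
   Module.finrank E (E[X] ⧸ Ideal.span {f}) = f.natDegree := by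
  have := (AdjoinRoot.powerBasis hf).finrank
  rw [AdjoinRoot.powerBasis_dim] at this
  exact this

lemma norm_lin {E : Type*} [Field E] (f : E[X]) (hf : f ≠ 0) (a : E) :
    Algebra.norm E (Ideal.Quotient.mk (Ideal.span {f}) (X - C a)) =
      (-1) ^ f.natDegree * (f.eval a / f.leadingCoeff) := by
  have hc : f.leadingCoeff⁻¹ ≠ 0 := inv_ne_zero (leadingCoeff_ne_zero.2 hf)
  rw [norm_res f hf, natDegree_X_sub_C, resultant_X_sub_C_right _ _ _ le_rfl, natDegree_mul_C hc]
  simp [div_eq_mul_inv]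

lemma coprime_of_unit {E : Type*} [Field E] (f g : E[X])
    (h : IsUnit (Ideal.Quotient.mk (Ideal.span {f}) g)) : IsCoprime f g := by
  obtain ⟨v, hv⟩ := h.exists_right_inv
  obtain ⟨q, rfl⟩ := Ideal.Quotient.mk_surjective v
  rw [← map_mul, ← map_one (Ideal.Quotient.mk (Ideal.span {f})), Ideal.Quotient.eq, Ideal.mem_span_singleton] at hv
  obtain ⟨r, hr⟩ := hv
  exact ⟨-r, q, by linear_combination hr⟩

lemma unit_of_coprime {E : Type*} [Field E] (f g : E[X]) (h : IsCoprime f g) :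
    IsUnit (Ideal.Quotient.mk (Ideal.span {f}) g) := by
  obtain ⟨a, b, hab⟩ := h
  refine IsUnit.of_mul_eq_one (Ideal.Quotient.mk (Ideal.span {f}) b) ?_
  rw [← map_mul, ← map_one (Ideal.Quotient.mk (Ideal.span {f})), Ideal.Quotient.eq, Ideal.mem_span_singleton]
  exact ⟨-a, by linear_combination hab⟩

lemma sq_of_dvd {E : Type*} [Field E] (f g l : E[X]) (h : g ∣ f - l ^ 2) :
    IsSquare (Ideal.Quotient.mk (Ideal.span {g}) f) := by
  refine ⟨Ideal.Quotient.mk _ l, ?_⟩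
  rw [← map_mul, Ideal.Quotient.eq, Ideal.mem_span_singleton, ← sq]
  exact h

lemma odd_point {E : Type*} [Field E] (f : E[X]) (hpt : ∃ x y : AlgebraicClosure E, y ^ 2 = aeval x f ∧
    Odd (Module.finrank E ↥(Algebra.adjoin E ({x, y} : Set (AlgebraicClosure E))))) :
    ∃ h q : E[X], Irreducible h ∧ h.Monic ∧ Odd h.natDegree ∧ h ∣ f - q ^ 2 := by
  obtain ⟨x, y, hxy, hodd⟩ := hpt
  have hx : IsIntegral E x := Algebra.IsIntegral.isIntegral x
  have hy : IsIntegral (IntermediateField.adjoin E {x}) y := (Algebra.IsIntegral.isIntegral (R := E) y).tower_top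
  have e1 : Module.finrank E (Algebra.adjoin E ({x, y} : Set (AlgebraicClosure E))) =
      Module.finrank E (IntermediateField.adjoin E {x}) *
      Module.finrank (IntermediateField.adjoin E {x}) (IntermediateField.adjoin (IntermediateField.adjoin E {x}) {y}) := by
    have : Algebra.adjoin E ({x, y} : Set (AlgebraicClosure E)) = (IntermediateField.adjoin E {x, y}).toSubalgebra := by
      symm
      apply IntermediateField.adjoin_toSubalgebra_of_isAlgebraic
      exact fun z _ => Algebra.IsAlgebraic.isAlgebraic z
    rw [this, ← IntermediateField.adjoin_simple_adjoin_simple]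
    exact (Module.finrank_mul_finrank E (IntermediateField.adjoin E {x}) (IntermediateField.adjoin (IntermediateField.adjoin E {x}) {y})).symm
  rw [e1, IntermediateField.adjoin.finrank hx, IntermediateField.adjoin.finrank hy, Nat.odd_mul] at hodd
  obtain ⟨o1, o2⟩ := hodd
  have hmem : aeval x f ∈ IntermediateField.adjoin E {x} := by
    have := aeval_algebraMap_apply (AlgebraicClosure E) (IntermediateField.AdjoinSimple.gen E x) f
    rw [IntermediateField.AdjoinSimple.algebraMap_gen] at this
    rw [this]
    exact Subtype.property _
  have hdvd : minpoly (IntermediateField.adjoin E {x}) y ∣ X ^ 2 - C ⟨_, hmem⟩ := by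
    apply minpoly.dvd
    simp [hxy]
  have hle := natDegree_le_of_dvd hdvd (X_pow_sub_C_ne_zero (by norm_num) _)
  rw [natDegree_X_pow_sub_C] at hle
  have h1 : (minpoly (IntermediateField.adjoin E {x}) y).natDegree = 1 := by
    obtain ⟨k, hk⟩ := o2
    omega
  have hmy := minpoly.natDegree_eq_one_iff.1 h1
  obtain ⟨z, hz⟩ := hmy
  have hz2 : (z : AlgebraicClosure E) ∈ (IntermediateField.adjoin E {x}).toSubalgebra := z.2
  rw [IntermediateField.adjoin_simple_toSubalgebra_of_isAlgebraic hx.isAlgebraic,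
    Algebra.adjoin_singleton_eq_range_aeval] at hz2
  obtain ⟨q, hq⟩ := hz2
  refine ⟨minpoly E x, q, minpoly.irreducible hx, minpoly.monic hx, o1, minpoly.dvd _ _ ?_⟩
  have hq' : aeval x q = y := hq.trans hz
  rw [map_sub, map_pow, hq', hxy, sub_self]

lemma norm_unit_ne {E : Type*} [Field E] {A : Type*} [CommRing A] [Algebra E A] (a : A) (h : IsUnit a) :
    Algebra.norm E a ≠ 0 := (h.map (Algebra.norm E)).ne_zero

lemma exists_gamma {E : Type*} [Field E] (f : E[X]) (hf : f ≠ 0) (hsq : Squarefree f)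
    (hev : Even f.natDegree) (h q : E[X]) (hi : Irreducible h) (hm : h.Monic) (ho : Odd h.natDegree)
    (hd : h ∣ f - q ^ 2) :
    ∃ p : E[X], IsUnit (Ideal.Quotient.mk (Ideal.span {f}) p) ∧
      ∃ u : E, Algebra.norm E (Ideal.Quotient.mk (Ideal.span {f}) p) = f.leadingCoeff * u ^ 2 := by
  have hc : f.leadingCoeff ≠ 0 := leadingCoeff_ne_zero.2 hf
  have hnh : ∀ p, Algebra.norm E (Ideal.Quotient.mk (Ideal.span {h}) p) = resultant h p := by
    intro p
    rw [norm_res h hm.ne_zero, hm.leadingCoeff, inv_one, C_1, mul_one]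
  by_cases hdf : h ∣ f
  · obtain ⟨k, hk⟩ := hdf
    have hkc : IsCoprime h k := by
      refine hi.isCoprime_or_dvd k |>.resolve_right ?_
      rintro ⟨l, rfl⟩
      exact hi.not_isUnit (hsq h ⟨l, by rw [hk]; ring⟩)
    have hk0 : k ≠ 0 := by rintro rfl; simp at hk; exact hf hk
    have hlk : f.leadingCoeff = k.leadingCoeff := by
      rw [hk, leadingCoeff_mul, hm.leadingCoeff, one_mul]
    have hdk : f.natDegree = h.natDegree + k.natDegree := by
      rw [hk, natDegree_mul hm.ne_zero hk0]
    have hko : Odd k.natDegree := by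
      rw [hdk] at hev
      by_contra hh
      rw [Nat.not_odd_iff_even] at hh
      exact Nat.not_even_iff_odd.2 (ho.add_even hh) hev
    obtain ⟨a, b, hab⟩ := hkc
    set c := f.leadingCoeff with hcdef
    have hCc : C c⁻¹ * C c = 1 := by rw [← C_mul, inv_mul_cancel₀ hc, C_1]
    let p := b * k + C c * (a * h)
    refine ⟨p, unit_of_coprime _ _ ?_, ?_⟩
    · rw [hk]
      refine IsCoprime.mul_left ⟨(1 - C c) * a, 1, ?_⟩ ⟨- C c⁻¹ * (1 - C c) * b, C c⁻¹, ?_⟩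
      · simp only [p]; linear_combination hab
      · simp only [p]; linear_combination (C c⁻¹ * C c) * hab + hCc
    · obtain ⟨j, hj⟩ := hko
      refine ⟨c ^ j, ?_⟩
      have hcinv : c⁻¹ ≠ 0 := inv_ne_zero hc
      have e1 : f * C c⁻¹ = h * (k * C c⁻¹) := by rw [hk]; ring
      have e2 : (f * C c⁻¹).natDegree = h.natDegree + (k * C c⁻¹).natDegree := by
        rw [natDegree_mul_C hcinv, natDegree_mul_C hcinv, hdk]
      have n1 : Algebra.norm E (Ideal.Quotient.mk (Ideal.span {h}) p) = 1 := by
        have : Ideal.Quotient.mk (Ideal.span {h}) p = Ideal.Quotient.mk (Ideal.span {h}) 1 := by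
          rw [Ideal.Quotient.eq, Ideal.mem_span_singleton]
          exact ⟨(C c - 1) * a, by simp only [p]; linear_combination hab⟩
        rw [this, map_one, map_one]
      have n2 : Algebra.norm E (Ideal.Quotient.mk (Ideal.span {k}) p) = c ^ k.natDegree := by
        have : Ideal.Quotient.mk (Ideal.span {k}) p = Ideal.Quotient.mk (Ideal.span {k}) (C c) := by
          rw [Ideal.Quotient.eq, Ideal.mem_span_singleton]
          exact ⟨(1 - C c) * b, by simp only [p]; linear_combination C c * hab⟩
        rw [this, ← finrank_quot k hk0]
        exact Algebra.norm_algebraMap c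
      rw [hnh] at n1
      rw [norm_res k hk0, ← hlk] at n2
      rw [norm_res f hf, ← hcdef, e2, e1, resultant_mul_left _ _ _ _ le_rfl, n1, n2, hj]
      ring
  · have hcop : IsCoprime f h := (hi.isCoprime_or_dvd f |>.resolve_right hdf).symm
    refine ⟨h, unit_of_coprime _ _ hcop, ?_⟩
    have hcinv : f.leadingCoeff⁻¹ ≠ 0 := inv_ne_zero hc
    obtain ⟨j, hj⟩ := ho
    refine ⟨Algebra.norm E (Ideal.Quotient.mk (Ideal.span {h}) q) * f.leadingCoeff⁻¹ ^ (j + 1), ?_⟩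
    have e1 : Ideal.Quotient.mk (Ideal.span {h}) f = Ideal.Quotient.mk (Ideal.span {h}) q ^ 2 := by
      rw [← map_pow, Ideal.Quotient.eq, Ideal.mem_span_singleton]
      exact hd
    have e2 : Algebra.norm E (Ideal.Quotient.mk (Ideal.span {h}) (C f.leadingCoeff⁻¹)) =
        f.leadingCoeff⁻¹ ^ h.natDegree := by
      rw [← finrank_quot h hm.ne_zero]
      exact Algebra.norm_algebraMap _
    have e3 : Even ((f * C f.leadingCoeff⁻¹).natDegree * h.natDegree) := by
      rw [natDegree_mul_C hcinv]
      exact hev.mul_right _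
    rw [norm_res f hf, resultant_comm, e3.neg_one_pow, one_mul, ← hnh, map_mul, map_mul, e1, e2, map_pow, hj]
    have e4 : f.leadingCoeff * f.leadingCoeff⁻¹ = 1 := mul_inv_cancel₀ hc
    generalize Algebra.norm E (Ideal.Quotient.mk (Ideal.span {h}) q) = N
    generalize f.leadingCoeff⁻¹ = d at e4
    linear_combination (-(N ^ 2 * d ^ (2 * j + 1))) * e4

lemma units_aux {G : Type*} [CommRing G] (α γ β₁ β₂ : Gˣ) (h : γ * β₁ ^ 2 = α * γ * β₂ ^ 2) :
    1 = α * (β₂ * β₁⁻¹) ^ 2 := by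
  rw [mul_comm α γ, mul_assoc] at h
  have h2 := mul_left_cancel h
  rw [mul_pow, inv_pow, ← mul_assoc, ← h2, mul_inv_cancel]

theorem main_aux (E : Type*) [Field E]
    (f : Polynomial E) (hdeg : 0 < f.natDegree) (hsep : f.Separable)
    (hpt : ∃ h q : E[X], Irreducible h ∧ h.Monic ∧ Odd h.natDegree ∧ h ∣ f - q ^ 2)
    (hlin : ∀ α : (Polynomial E ⧸ Ideal.span {f})ˣ, ∃ a : E,
      ∃ β : (Polynomial E ⧸ Ideal.span {f})ˣ,
        Ideal.Quotient.mk (Ideal.span {f}) (X - C a)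
          = (α : Polynomial E ⧸ Ideal.span {f}) * (β : Polynomial E ⧸ Ideal.span {f}) ^ 2)
    (α : (Polynomial E ⧸ Ideal.span {f})ˣ)
    (hα : ∃ u : Eˣ, Algebra.norm E (α : Polynomial E ⧸ Ideal.span {f}) = (u : E) ^ 2 ∨
               Algebra.norm E (α : Polynomial E ⧸ Ideal.span {f}) = f.leadingCoeff * (u : E) ^ 2) :
    ∃ g : Polynomial E,
      (∃ β : (Polynomial E ⧸ Ideal.span {f})ˣ,
        Ideal.Quotient.mk (Ideal.span {f}) g
          = (α : Polynomial E ⧸ Ideal.span {f}) * (β : Polynomial E ⧸ Ideal.span {f}) ^ 2) ∧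
      IsSquare (Ideal.Quotient.mk (Ideal.span {g}) f) := by
  have hf : f ≠ 0 := by rintro rfl; simp at hdeg
  have hc : f.leadingCoeff ≠ 0 := leadingCoeff_ne_zero.2 hf
  rcases Nat.even_or_odd f.natDegree with hev | hodd
  · -- even degree
    have P : ∀ (γ : (Polynomial E ⧸ Ideal.span {f})ˣ) (u : E),
        Algebra.norm E (γ : Polynomial E ⧸ Ideal.span {f}) = f.leadingCoeff * u ^ 2 →
        ∃ b s : E, ∃ β : (Polynomial E ⧸ Ideal.span {f})ˣ,
          Ideal.Quotient.mk (Ideal.span {f}) (X - C b)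
            = (γ : Polynomial E ⧸ Ideal.span {f}) * (β : Polynomial E ⧸ Ideal.span {f}) ^ 2 ∧
          f.eval b = s ^ 2 := by
      intro γ u hu
      obtain ⟨b, β, hb⟩ := hlin γ
      refine ⟨b, f.leadingCoeff * u * Algebra.norm E (β : Polynomial E ⧸ Ideal.span {f}), β, hb, ?_⟩
      have := congrArg (Algebra.norm E) hb
      rw [norm_lin f hf, hev.neg_one_pow, one_mul, map_mul, map_pow, hu, div_eq_iff hc] at this
      rw [this]; ring
    have D : ∀ (a s : E) (l : E[X]), f.eval a = s ^ 2 → l.eval a = s → X - C a ∣ f - l ^ 2 := by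
      intro a s l h1 h2
      rw [dvd_iff_isRoot]
      simp [h1, h2]
    obtain ⟨u, hu | hu⟩ := hα
    · obtain ⟨h, q, hi, hm, ho, hd⟩ := hpt
      obtain ⟨p, hp, v, hv⟩ := exists_gamma f hf hsep.squarefree hev h q hi hm ho hd
      obtain ⟨γ, hγ⟩ := hp
      rw [← hγ] at hv
      obtain ⟨b, t, β₁, hb, ht⟩ := P γ v hv
      obtain ⟨a, s, β₂, ha, hs⟩ := P (α * γ) (u * v) (by
        rw [Units.val_mul, map_mul, hu, hv]; ring)
      by_cases hab : a = b
      · subst hab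
        refine ⟨1, ⟨β₂ * β₁⁻¹, ?_⟩, sq_of_dvd _ _ 0 (one_dvd _)⟩
        rw [hb] at ha
        have h3 : γ * β₁ ^ 2 = α * γ * β₂ ^ 2 := by
          apply Units.ext; push_cast; exact ha
        have h4 := units_aux α γ β₁ β₂ h3
        have h6 := congrArg Units.val h4
        rw [map_one]
        push_cast at h6 ⊢
        exact h6
      · refine ⟨(X - C a) * (X - C b), ⟨γ * β₁ * β₂, ?_⟩, ?_⟩
        · rw [map_mul, ha, hb]; push_cast; ring
        · have hba : b - a ≠ 0 := sub_ne_zero.2 (Ne.symm hab)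
          refine sq_of_dvd _ _ (C s + C ((t - s) / (b - a)) * (X - C a)) ?_
          refine IsCoprime.mul_dvd (isCoprime_X_sub_C_of_isUnit_sub (sub_ne_zero.2 hab).isUnit) (D a s _ hs ?_) (D b t _ ht ?_)
          · simp
          · simp only [eval_add, eval_mul, eval_C, eval_sub, eval_X]
            field_simp; ring
    · obtain ⟨b, t, β₁, hb, ht⟩ := P α u hu
      exact ⟨X - C b, ⟨β₁, hb⟩, sq_of_dvd _ _ (C t) (D b t _ ht (by simp))⟩
  · -- odd degree
    set n := Algebra.norm E (α : Polynomial E ⧸ Ideal.span {f}) with hn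
    have hn0 : n ≠ 0 := norm_unit_ne _ α.isUnit
    let e : E := - f.leadingCoeff * n
    have he : e ≠ 0 := mul_ne_zero (neg_ne_zero.2 hc) hn0
    let e' : (Polynomial E ⧸ Ideal.span {f})ˣ :=
      Units.map (algebraMap E (Polynomial E ⧸ Ideal.span {f})).toMonoidHom (Units.mk0 e he)
    have he' : (e' : Polynomial E ⧸ Ideal.span {f}) = Ideal.Quotient.mk (Ideal.span {f}) (C e) := rfl
    obtain ⟨a, β, hb⟩ := hlin (α * e')
    have hne : Algebra.norm E (e' : Polynomial E ⧸ Ideal.span {f}) = e ^ f.natDegree := by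
      rw [← finrank_quot f hf]
      exact Algebra.norm_algebraMap e
    obtain ⟨j, hj⟩ := hodd
    have hs : f.eval a = (e ^ (j + 1) * Algebra.norm E (β : Polynomial E ⧸ Ideal.span {f})) ^ 2 := by
      have := congrArg (Algebra.norm E) hb
      rw [norm_lin f hf, Odd.neg_one_pow ⟨j, hj⟩, Units.val_mul, map_mul, map_mul, map_pow, hne, ← hn, neg_one_mul,
        ← neg_div, div_eq_iff hc, hj] at this
      have h2 : e = - f.leadingCoeff * n := rfl
      have h3 : e ^ (j + 1) * e ^ (j + 1) = e * e ^ (2 * j + 1) := by ring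
      rw [sq, mul_mul_mul_comm, h3]
      linear_combination - this - e ^ (2 * j + 1) * (Algebra.norm E (β : Polynomial E ⧸ Ideal.span {f})) ^ 2 * h2
    refine ⟨C e * (X - C a), ⟨e' * β, ?_⟩, sq_of_dvd _ _ (C (e ^ (j + 1) * Algebra.norm E (β : Polynomial E ⧸ Ideal.span {f}))) ?_⟩
    · rw [map_mul, hb, ← he']; push_cast; ring
    · rw [IsUnit.mul_left_dvd (isUnit_C.2 he.isUnit), dvd_iff_isRoot]
      simp [hs]

/-- If `f` is a nonconstant separable polynomial such that the affine curve `Y² = f(X)`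
has a point of odd degree, and every square class of `E_f = E[X]/(f)` is represented by
`θ - a` for some `a ∈ E` (where `θ` is the class of `X`), then `f` is square-reflexive. -/
theorem statement18 (E : Type*) [Field E] (hchar : ringChar E ≠ 2)
    (f : Polynomial E) (hdeg : 0 < f.natDegree) (hsep : f.Separable)
    (hpt : HasOddDegreePoint E f)
    (hlin : ∀ α : (Polynomial E ⧸ Ideal.span {f})ˣ, ∃ a : E,
      ∃ β : (Polynomial E ⧸ Ideal.span {f})ˣ,
        Ideal.Quotient.mk (Ideal.span {f}) (X - C a)
          = (α : Polynomial E ⧸ Ideal.span {f}) * (β : Polynomial E ⧸ Ideal.span {f}) ^ 2) :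
    IsSquareReflexive f := by
  refine ⟨hsep.squarefree, fun α hα => ?_⟩
  obtain ⟨g, ⟨β, hβ⟩, hg⟩ := main_aux E f hdeg hsep (odd_point f hpt) hlin α hα
  refine ⟨g, coprime_of_unit f g ?_, ⟨β, hβ⟩, hg⟩
  rw [hβ]
  exact α.isUnit.mul (β.isUnit.pow 2)
end
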